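/- Let n ≥ 1, let φ be a norm on ℝⁿ, let Ω ⊆ ℝⁿ be a nonempty open set of finite Lebesgue measure, and let m ≥ 0. If u is a minimizer of problem (1), then u ∈ L^∞(ℝⁿ); that is, there exists j ∈ ℕ such that u(x) ≤ j for a.e. x ∈ ℝⁿ (equivalently, the level set E_j = {u ≥ j} has Lebesgue measure zero for all sufficiently large j). -/

import Mathlib

open MeasureTheory Set ENNReal Filter

noncomputable section

/-- `φ` is a norm on `ℝⁿ` (represented as `Fin n → ℝ`). -/
structure IsNorm {n : ℕ} (φ : (Fin n → ℝ) → ℝ) : Prop where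
  nonneg : ∀ x, 0 ≤ φ x
  eq_zero_iff : ∀ x, φ x = 0 ↔ x = 0
  smul_eq : ∀ (a : ℝ) (x : Fin n → ℝ), φ (a • x) = |a| * φ x
  add_le : ∀ x y, φ (x + y) ≤ φ x + φ y

/-- The divergence of a vector field `η : ℝⁿ → ℝⁿ`. -/
def diverg {n : ℕ} (η : (Fin n → ℝ) → (Fin n → ℝ)) (x : Fin n → ℝ) : ℝ :=
  ∑ i, fderiv ℝ η x (Pi.single i 1) i

/-- The anisotropic total variation `∫ φ*(Du)` of `u : ℝⁿ → ℝ`: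
`sup { ∫ u div η dx : η ∈ C¹_c(ℝⁿ;ℝⁿ), φ(η(x)) ≤ 1 ∀ x }`, as an extended real. -/
def anisoTV {n : ℕ} (φ : (Fin n → ℝ) → ℝ) (u : (Fin n → ℝ) → ℝ) : ℝ≥0∞ :=
  ⨆ η ∈ {η : (Fin n → ℝ) → (Fin n → ℝ) |
      ContDiff ℝ 1 η ∧ HasCompactSupport η ∧ ∀ x, φ (η x) ≤ 1},
    ENNReal.ofReal (∫ x, u x * diverg η x)

/-- `u ∈ BV(ℝⁿ)` (with respect to the anisotropic total variation). -/
def IsBV {n : ℕ} (φ : (Fin n → ℝ) → ℝ) (u : (Fin n → ℝ) → ℝ) : Prop :=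
  Integrable u volume ∧ anisoTV φ u ≠ ⊤

/-- `u` is admissible for problem (1): `u ∈ BV(ℝⁿ)`, `u = 0` a.e. outside `Ω`,
`u` is a.e. `ℕ`-valued, and `∫_Ω u = m`. -/
def Admissible {n : ℕ} (φ : (Fin n → ℝ) → ℝ) (Ω : Set (Fin n → ℝ)) (m : ℝ)
    (u : (Fin n → ℝ) → ℝ) : Prop :=
  IsBV φ u ∧ (∀ᵐ x ∂volume, x ∉ Ω → u x = 0) ∧
    (∀ᵐ x ∂volume, ∃ k : ℕ, u x = k) ∧ (∫ x in Ω, u x) = m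

/-- `u` is a minimizer of problem (1). -/
def IsMinimizer {n : ℕ} (φ : (Fin n → ℝ) → ℝ) (Ω : Set (Fin n → ℝ)) (m : ℝ)
    (u : (Fin n → ℝ) → ℝ) : Prop :=
  Admissible φ Ω m u ∧ ∀ v, Admissible φ Ω m v → anisoTV φ u ≤ anisoTV φ v

/-- The anisotropic perimeter `P_φ(E)` of a set `E ⊆ ℝⁿ`. -/
def anisoPerimeter {n : ℕ} (φ : (Fin n → ℝ) → ℝ) (E : Set (Fin n → ℝ)) : ℝ≥0∞ :=
  anisoTV φ (E.indicator (1 : (Fin n → ℝ) → ℝ))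

/-- The Wulff ball `W_r(x) = {y : φ(y-x) < r}`. -/
def wulffBall {n : ℕ} (φ : (Fin n → ℝ) → ℝ) (x : Fin n → ℝ) (r : ℝ) : Set (Fin n → ℝ) :=
  {y | φ (y - x) < r}

/-- `E` satisfies the `rW_φ`-condition. -/
def rWCond {n : ℕ} (φ : (Fin n → ℝ) → ℝ) (E : Set (Fin n → ℝ)) (r : ℝ) : Prop :=
  ∀ x ∈ frontier E, ∃ y, wulffBall φ y r ⊆ E ∧ x ∈ frontier (wulffBall φ y r)

/-- The Wulff plaquette `E^r`, the union of all Wulff balls of radius `r` contained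
in `E` (with `E^0 = E`). -/
def plaquette {n : ℕ} (φ : (Fin n → ℝ) → ℝ) (E : Set (Fin n → ℝ)) (r : ℝ) :
    Set (Fin n → ℝ) :=
  if r = 0 then E else ⋃ (x) (_ : wulffBall φ x r ⊆ E), wulffBall φ x r

/-- `R_Ω`: the maximal `R > 0` such that some Wulff ball of radius `R` is contained in `Ω`. -/
def maxInradius {n : ℕ} (φ : (Fin n → ℝ) → ℝ) (Ω : Set (Fin n → ℝ)) : ℝ :=
  sSup {R | 0 < R ∧ ∃ x, wulffBall φ x R ⊆ Ω}

/-- `r_Ω`: the maximal `r > 0` such that `Ω` satisfies the `rW_φ`-condition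
(`0` if there is none, since `sSup ∅ = 0`). -/
def maxRollRadius {n : ℕ} (φ : (Fin n → ℝ) → ℝ) (Ω : Set (Fin n → ℝ)) : ℝ :=
  sSup {r | 0 < r ∧ rWCond φ Ω r}

/-- The set of points of Lebesgue density `1` of `E`. -/
def densityPoints {n : ℕ} (E : Set (Fin n → ℝ)) : Set (Fin n → ℝ) :=
  {x | Tendsto (fun r : ℝ => volume (E ∩ Metric.ball x r) / volume (Metric.ball x r))
    (nhdsWithin 0 (Ioi 0)) (nhds 1)}

/-- `E` is a minimizer of problem (10): the constrained isoperimetric problem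
minimizing `P_φ` among measurable subsets of `Ω` of prescribed measure `m`. -/
def IsIsopMinimizer {n : ℕ} (φ : (Fin n → ℝ) → ℝ) (Ω : Set (Fin n → ℝ)) (m : ℝ)
    (E : Set (Fin n → ℝ)) : Prop :=
  MeasurableSet E ∧ E ⊆ Ω ∧ (volume E).toReal = m ∧
    ∀ F, MeasurableSet F → F ⊆ Ω → (volume F).toReal = m →
      anisoPerimeter φ E ≤ anisoPerimeter φ F

/-- The Euclidean norm on `ℝ²`. -/
def euclNorm (v : Fin 2 → ℝ) : ℝ := Real.sqrt (v 0 ^ 2 + v 1 ^ 2)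

/-- The crystalline norm `φ(ν) = |ν₁| + |ν₂|` on `ℝ²`. -/
def crysNorm (v : Fin 2 → ℝ) : ℝ := |v 0| + |v 1|

/-- The open unit square `(0,1)² ⊆ ℝ²`. -/
def unitSquare : Set (Fin 2 → ℝ) := univ.pi fun _ => Ioo (0 : ℝ) 1

/-- The closed unit square `[0,1]² ⊆ ℝ²`. -/
def closedUnitSquare : Set (Fin 2 → ℝ) := univ.pi fun _ => Icc (0 : ℝ) 1

/-- `j` is the essential supremum `‖u‖_∞` of `u`. -/
def IsEssSup (u : (Fin 2 → ℝ) → ℝ) (j : ℕ) : Prop :=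
  (∀ᵐ x ∂volume, u x ≤ (j : ℝ)) ∧ ∀ c : ℝ, (∀ᵐ x ∂volume, u x ≤ c) → (j : ℝ) ≤ c

open Pointwise in
theorem volume_add_volume_le_of_isCompact {K L : Set ℝ} (hK : IsCompact K) (hL : IsCompact L)
    (hKne : K.Nonempty) (hLne : L.Nonempty) : volume K + volume L ≤ volume (K + L) := by
  obtain ⟨a, haK, ha⟩ := hK.exists_isGreatest hKne
  obtain ⟨b, hbL, hb⟩ := hL.exists_isLeast hLne
  have h1 : (fun x => x + b) '' K ∪ (fun y => a + y) '' L ⊆ K + L := by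
    rintro _ (⟨x, hx, rfl⟩ | ⟨y, hy, rfl⟩)
    · exact add_mem_add hx hbL
    · exact add_mem_add haK hy
  have h2 : volume (((fun x => x + b) '' K) ∩ ((fun y => a + y) '' L)) = 0 := by
    refine measure_mono_null (t := {a + b}) ?_ (by simp)
    rintro _ ⟨⟨x, hx, rfl⟩, ⟨y, hy, hxy⟩⟩
    have := ha hx
    have := hb hy
    simp only [mem_singleton_iff] at *
    linarith
  have hm : MeasurableSet ((fun y => a + y) '' L) :=
    (hL.image (by fun_prop)).measurableSet
  calc volume K + volume L
      = volume ((fun x => x + b) '' K) + volume ((fun y => a + y) '' L) := by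
        simp [image_add_right, image_add_left, measure_preimage_add_right, measure_preimage_add]
    _ = volume ((fun x => x + b) '' K ∪ (fun y => a + y) '' L) := by
        rw [← measure_union_add_inter _ hm, h2, add_zero]
    _ ≤ volume (K + L) := measure_mono h1

open Pointwise in
theorem volume_smul_add_le_of_forall_mem {A B C : Set ℝ} (hA : MeasurableSet A)
    (hB : MeasurableSet B) (hAne : A.Nonempty) (hBne : B.Nonempty) {s t : ℝ} (hs : 0 < s)
    (ht : 0 < t) (h : ∀ x ∈ A, ∀ y ∈ B, s * x + t * y ∈ C) :
    ENNReal.ofReal s * volume A + ENNReal.ofReal t * volume B ≤ volume C := by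
  have key : ∀ {A : Set ℝ}, MeasurableSet A → A.Nonempty → ∀ r < volume A,
      ∃ K ⊆ A, IsCompact K ∧ K.Nonempty ∧ r ≤ volume K := by
    intro A hA _ r hr
    obtain ⟨K, hKA, hK, hrK⟩ := hA.exists_lt_isCompact hr
    refine ⟨K, hKA, hK, ?_, hrK.le⟩
    by_contra hne
    rw [not_nonempty_iff_eq_empty] at hne
    simp [hne] at hrK
  have key' : ∀ {A : Set ℝ}, MeasurableSet A → A.Nonempty → 
      ⨆ K : {K : Set ℝ // K ⊆ A ∧ IsCompact K ∧ K.Nonempty}, volume K.1 = volume A := by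
    intro A hA hne
    apply le_antisymm
    · exact iSup_le fun K => measure_mono K.2.1
    · refine le_of_forall_lt fun r hr => ?_
      obtain ⟨r', hr, hr'⟩ := exists_between hr
      obtain ⟨K, h1, h2, h3, h4⟩ := key hA hne r' hr'
      exact (hr.trans_le h4).trans_le (le_iSup
        (fun K : {K : Set ℝ // K ⊆ A ∧ IsCompact K ∧ K.Nonempty} => volume K.1) ⟨K, h1, h2, h3⟩)
  rw [← key' hA hAne, ← key' hB hBne, ENNReal.mul_iSup, ENNReal.mul_iSup]
  obtain ⟨a, ha⟩ := hAne
  obtain ⟨b, hb⟩ := hBne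
  have : Nonempty {K : Set ℝ // K ⊆ A ∧ IsCompact K ∧ K.Nonempty} :=
    ⟨⟨{a}, by simpa, isCompact_singleton, by simp⟩⟩
  have : Nonempty {K : Set ℝ // K ⊆ B ∧ IsCompact K ∧ K.Nonempty} :=
    ⟨⟨{b}, by simpa, isCompact_singleton, by simp⟩⟩
  refine ENNReal.iSup_add_iSup_le fun K L => ?_
  have h1 := volume_add_volume_le_of_isCompact (K.2.2.1.smul s) (L.2.2.1.smul t)
    (K.2.2.2.smul_set) (L.2.2.2.smul_set)
  rw [Measure.addHaar_smul, Measure.addHaar_smul] at h1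
  simp only [Module.finrank_self, pow_one, abs_of_pos hs, abs_of_pos ht] at h1
  refine h1.trans (measure_mono ?_)
  rintro _ ⟨_, ⟨x, hx, rfl⟩, _, ⟨y, hy, rfl⟩, rfl⟩
  exact h x (K.2.1 hx) y (L.2.1 hy)

theorem ENNReal.rpow_mul_rpow_le_add {a b : ℝ≥0∞} {s t : ℝ} (hs : 0 < s) (ht : 0 < t)
    (hst : s + t = 1) : a ^ s * b ^ t ≤ ENNReal.ofReal s * a + ENNReal.ofReal t * b := by
  by_cases ha : a = ∞
  · subst ha
    rw [ENNReal.mul_top (by simpa using hs)]; simp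
  by_cases hb : b = ∞
  · subst hb
    rw [ENNReal.mul_top (by simpa using ht)]; simp
  lift a to NNReal using ha
  lift b to NNReal using hb
  have := NNReal.geom_mean_le_arith_mean2_weighted (s.toNNReal) (t.toNNReal) a b (by
    rw [← Real.toNNReal_add hs.le ht.le, hst, Real.toNNReal_one])
  simp only [Real.coe_toNNReal _ hs.le, Real.coe_toNNReal _ ht.le] at this
  rw [← ENNReal.coe_rpow_of_nonneg _ hs.le, ← ENNReal.coe_rpow_of_nonneg _ ht.le]
  simp only [ENNReal.ofReal]
  exact_mod_cast this

theorem lintegral_eq_setLIntegral_meas_lt_of_le_one {f : ℝ → ℝ≥0∞} (hf : Measurable f)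
    (h1 : ∀ x, f x ≤ 1) :
    ∫⁻ x, f x = ∫⁻ t in Ioo (0 : ℝ) 1, volume {x | ENNReal.ofReal t < f x} := by
  have hne : ∀ x, f x ≠ ∞ := fun x => ((h1 x).trans_lt one_lt_top).ne
  have h := lintegral_eq_lintegral_meas_lt volume (f := fun x => (f x).toReal)
    (Eventually.of_forall fun x => toReal_nonneg) hf.ennreal_toReal.aemeasurable
  simp only [ENNReal.ofReal_toReal (hne _)] at h
  rw [h]
  have e : ∀ t ∈ Ioi (0 : ℝ), volume {x | t < (f x).toReal} =
      (Ioo (0 : ℝ) 1).indicator (fun t => volume {x | ENNReal.ofReal t < f x}) t := by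
    intro t ht
    have ht : 0 < t := ht
    by_cases ht1 : t < 1
    · rw [indicator_of_mem (show t ∈ Ioo (0 : ℝ) 1 from ⟨ht, ht1⟩)]
      congr 1; ext x
      simp only [mem_ofPred_eq]
      rw [ENNReal.ofReal_lt_iff_lt_toReal ht.le (hne x)]
    · rw [indicator_of_notMem (fun h => ht1 h.2)]
      rw [show {x | t < (f x).toReal} = ∅ from ?_, measure_empty]
      ext x
      simp only [mem_ofPred_eq, mem_empty_iff_false, iff_false, not_lt]
      have := ENNReal.toReal_mono one_ne_top (h1 x)
      simp at this
      linarith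
  rw [setLIntegral_congr_fun measurableSet_Ioi e, lintegral_indicator measurableSet_Ioo,
    Measure.restrict_restrict measurableSet_Ioo, inter_eq_left.2 Ioo_subset_Ioi_self]

theorem lintegral_add_le_of_iSup_eq_one {f g h : ℝ → ℝ≥0∞} (hf : Measurable f)
    (hg : Measurable g) (hh : Measurable h) {s t : ℝ} (hs : 0 < s) (ht : 0 < t) (hst : s + t = 1)
    (hfg : ∀ x y, f x ^ s * g y ^ t ≤ h (s * x + t * y)) (hf1 : ⨆ x, f x = 1)
    (hg1 : ⨆ x, g x = 1) :
    ENNReal.ofReal s * (∫⁻ x, f x) + ENNReal.ofReal t * (∫⁻ x, g x) ≤ ∫⁻ x, h x := by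
  have hfle : ∀ x, f x ≤ 1 := fun x => hf1 ▸ le_iSup f x
  have hgle : ∀ x, g x ≤ 1 := fun x => hg1 ▸ le_iSup g x
  have hm : ∀ {f : ℝ → ℝ≥0∞}, Antitone fun t : ℝ => volume {x | ENNReal.ofReal t < f x} :=
    fun {f} a b hab => measure_mono fun x hx => (ENNReal.ofReal_le_ofReal hab).trans_lt hx
  calc _ ≤ ∫⁻ x, min (h x) 1 := ?_
    _ ≤ ∫⁻ x, h x := lintegral_mono fun x => min_le_left _ _
  rw [lintegral_eq_setLIntegral_meas_lt_of_le_one hf hfle,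
    lintegral_eq_setLIntegral_meas_lt_of_le_one hg hgle,
    lintegral_eq_setLIntegral_meas_lt_of_le_one (hh.min measurable_const)
      (fun x => min_le_right _ _), ← lintegral_const_mul _ hm.measurable,
    ← lintegral_const_mul _ hm.measurable, ← lintegral_add_left (hm.measurable.const_mul _)]
  refine setLIntegral_mono hm.measurable fun r hr => ?_
  have hr1 : ENNReal.ofReal r < 1 := by
    rw [← ENNReal.ofReal_one]; exact (ENNReal.ofReal_lt_ofReal_iff one_pos).2 hr.2
  have hr0 : ENNReal.ofReal r ≠ 0 := by simpa using hr.1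
  have hrt : ENNReal.ofReal r ≠ ∞ := ofReal_ne_top
  refine volume_smul_add_le_of_forall_mem (measurableSet_lt measurable_const hf)
    (measurableSet_lt measurable_const hg) ?_ ?_ hs ht ?_
  · exact lt_iSup_iff.1 (hf1 ▸ hr1)
  · exact lt_iSup_iff.1 (hg1 ▸ hr1)
  · intro x hx y hy
    refine lt_min ?_ hr1
    refine lt_of_lt_of_le ?_ (hfg x y)
    calc ENNReal.ofReal r = ENNReal.ofReal r ^ s * ENNReal.ofReal r ^ t := by
          rw [← ENNReal.rpow_add _ _ hr0 hrt, hst, ENNReal.rpow_one]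
      _ < f x ^ s * g y ^ t := ENNReal.mul_lt_mul (ENNReal.rpow_lt_rpow hx hs)
          (ENNReal.rpow_lt_rpow hy ht)

theorem prekopa_leindler_real_of_bounded {f g h : ℝ → ℝ≥0∞} (hf : Measurable f)
    (hg : Measurable g) (hh : Measurable h) {s t : ℝ} (hs : 0 < s) (ht : 0 < t) (hst : s + t = 1)
    (hfg : ∀ x y, f x ^ s * g y ^ t ≤ h (s * x + t * y)) (hfb : ⨆ x, f x ≠ ∞)
    (hgb : ⨆ x, g x ≠ ∞) :
    (∫⁻ x, f x) ^ s * (∫⁻ x, g x) ^ t ≤ ∫⁻ x, h x := by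
  by_cases hf0 : ⨆ x, f x = 0
  · have : ∀ x, f x = 0 := fun x => le_zero_iff.1 (hf0 ▸ le_iSup f x)
    simp [this, hs]
  by_cases hg0 : ⨆ x, g x = 0
  · have : ∀ x, g x = 0 := fun x => le_zero_iff.1 (hg0 ▸ le_iSup g x)
    simp [this, ht]
  set a := ⨆ x, f x
  set b := ⨆ x, g x
  have hc0 : a ^ s * b ^ t ≠ 0 := mul_ne_zero (by simp [hf0, hfb]) (by simp [hg0, hgb])
  have hct : a ^ s * b ^ t ≠ ∞ := ENNReal.mul_ne_top (by simp [hs.le, hfb]) (by simp [ht.le, hgb])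
  have hscale : ∀ p q : ℝ≥0∞, (a⁻¹ * p) ^ s * (b⁻¹ * q) ^ t
      = (a ^ s * b ^ t)⁻¹ * (p ^ s * q ^ t) := by
    intro p q
    rw [ENNReal.mul_rpow_of_nonneg _ _ hs.le, ENNReal.mul_rpow_of_nonneg _ _ ht.le,
      ENNReal.mul_inv (by simp [hf0, hfb]) (by simp [hfb, hs.le]), ENNReal.inv_rpow,
      ENNReal.inv_rpow]
    ring
  have key := lintegral_add_le_of_iSup_eq_one (f := fun x => a⁻¹ * f x) (g := fun x => b⁻¹ * g x)
    (h := fun x => (a ^ s * b ^ t)⁻¹ * h x) (hf.const_mul _) (hg.const_mul _) (hh.const_mul _)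
    hs ht hst ?_ ?_ ?_
  · rw [lintegral_const_mul _ hf, lintegral_const_mul _ hg, lintegral_const_mul _ hh] at key
    have := (ENNReal.rpow_mul_rpow_le_add hs ht hst).trans key
    rw [hscale] at this
    rwa [ENNReal.mul_le_mul_iff_right (by simpa using hct) (by simpa using hc0)] at this
  · intro x y
    rw [hscale]
    gcongr
    exact hfg x y
  · rw [← ENNReal.mul_iSup]
    exact ENNReal.inv_mul_cancel hf0 hfb
  · rw [← ENNReal.mul_iSup]
    exact ENNReal.inv_mul_cancel hg0 hgb

theorem prekopa_leindler_real {f g h : ℝ → ℝ≥0∞} (hf : Measurable f)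
    (hg : Measurable g) (hh : Measurable h) {s t : ℝ} (hs : 0 < s) (ht : 0 < t) (hst : s + t = 1)
    (hfg : ∀ x y, f x ^ s * g y ^ t ≤ h (s * x + t * y)) :
    (∫⁻ x, f x) ^ s * (∫⁻ x, g x) ^ t ≤ ∫⁻ x, h x := by
  have key : ∀ {f : ℝ → ℝ≥0∞}, Measurable f → ∀ {s : ℝ}, 0 < s →
      (∫⁻ x, f x) ^ s = ⨆ N : ℕ, (∫⁻ x, min (f x) N) ^ s := by
    intro f hf s hs
    have h1 : ∀ x, f x = ⨆ N : ℕ, min (f x) N := by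
      intro x
      rw [← inf_iSup_eq (f x), ENNReal.iSup_natCast]
      simp
    conv_lhs => 
      enter [1,2,x]
      rw [h1 x]
    rw [lintegral_iSup (fun N => hf.min measurable_const)]
    · exact (ENNReal.orderIsoRpow s hs).map_iSup _
    · intro N M hNM x
      exact min_le_min_left _ (by exact_mod_cast hNM)
  have hmono : ∀ {f : ℝ → ℝ≥0∞} {s : ℝ}, 0 < s →
      Monotone fun N : ℕ => (∫⁻ x, min (f x) N) ^ s := fun hs N M hNM =>
    ENNReal.rpow_le_rpow (lintegral_mono fun x => min_le_min_left _ (by exact_mod_cast hNM)) hs.le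
  rw [key hf hs, key hg ht, ENNReal.iSup_mul]
  refine iSup_le fun N => ?_
  rw [ENNReal.mul_iSup]
  refine iSup_le fun M => ?_
  refine (mul_le_mul' (hmono hs (le_max_left N M)) (hmono ht (le_max_right N M))).trans ?_
  refine prekopa_leindler_real_of_bounded (hf.min measurable_const)
      (hg.min measurable_const) hh hs ht hst ?_ ?_ ?_
  · intro x y
    refine le_trans ?_ (hfg x y)
    gcongr <;> exact min_le_left _ _
  · exact ((iSup_le fun x => min_le_right _ _).trans_lt (ENNReal.natCast_lt_top _)).ne
  · exact ((iSup_le fun x => min_le_right _ _).trans_lt (ENNReal.natCast_lt_top _)).ne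

theorem lintegral_fin_cons {n : ℕ} {f : (Fin (n + 1) → ℝ) → ℝ≥0∞} (hf : Measurable f) :
    ∫⁻ x, f x = ∫⁻ a : ℝ, ∫⁻ y : Fin n → ℝ, f (Fin.cons a y) := by
  have e := (volume_preserving_piFinSuccAbove (fun _ : Fin (n + 1) => ℝ) 0).symm
  rw [← e.lintegral_comp hf, Measure.volume_eq_prod,
    lintegral_prod _ (by exact (hf.comp e.measurable).aemeasurable)]
  simp [Fin.insertNthEquiv, MeasurableEquiv.piFinSuccAbove_symm_apply]

theorem measurable_fin_cons {n : ℕ} :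
    Measurable fun p : ℝ × (Fin n → ℝ) => (Fin.cons p.1 p.2 : Fin (n + 1) → ℝ) := by
  refine measurable_pi_iff.2 fun i => ?_
  refine Fin.cases ?_ (fun j => ?_) i
  · simpa using measurable_fst
  · simp; fun_prop

/-- The **Prékopa–Leindler inequality** on `ℝⁿ`. -/
theorem prekopa_leindler {n : ℕ} {f g h : (Fin n → ℝ) → ℝ≥0∞} (hf : Measurable f)
    (hg : Measurable g) (hh : Measurable h) {s t : ℝ} (hs : 0 < s) (ht : 0 < t) (hst : s + t = 1)
    (hfg : ∀ x y, f x ^ s * g y ^ t ≤ h (s • x + t • y)) :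
    (∫⁻ x, f x) ^ s * (∫⁻ x, g x) ^ t ≤ ∫⁻ x, h x := by
  induction n with
  | zero =>
    rw [volume_pi, Measure.pi_of_empty, lintegral_dirac, lintegral_dirac, lintegral_dirac]
    refine (hfg _ _).trans_eq ?_
    congr 1
    exact Subsingleton.elim _ _
  | succ n ih =>
    have hm : ∀ {f : (Fin (n + 1) → ℝ) → ℝ≥0∞}, Measurable f →
        Measurable fun p : ℝ × (Fin n → ℝ) => f (Fin.cons p.1 p.2) :=
      fun hf => hf.comp measurable_fin_cons
    rw [lintegral_fin_cons hf, lintegral_fin_cons hg, lintegral_fin_cons hh]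
    refine prekopa_leindler_real (hm hf).lintegral_prod_right' (hm hg).lintegral_prod_right'
      (hm hh).lintegral_prod_right' hs ht hst fun a b => ?_
    refine ih ((hm hf).comp measurable_prodMk_left) ((hm hg).comp measurable_prodMk_left)
      ((hm hh).comp measurable_prodMk_left) fun x y => ?_
    refine (hfg _ _).trans_eq ?_
    congr 1
    ext i
    refine Fin.cases ?_ (fun j => ?_) i <;> simp

/-- The multiplicative form of the **Brunn–Minkowski inequality** on `ℝⁿ`. -/
theorem brunn_minkowski_rpow {n : ℕ} {A B C : Set (Fin n → ℝ)} (hA : MeasurableSet A)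
    (hB : MeasurableSet B) (hC : MeasurableSet C) {s t : ℝ} (hs : 0 < s) (ht : 0 < t)
    (hst : s + t = 1) (h : ∀ x ∈ A, ∀ y ∈ B, s • x + t • y ∈ C) :
    volume A ^ s * volume B ^ t ≤ volume C := by
  have := prekopa_leindler (f := A.indicator 1) (g := B.indicator 1) (h := C.indicator 1)
    (measurable_one.indicator hA) (measurable_one.indicator hB) (measurable_one.indicator hC)
    hs ht hst ?_
  · simpa [lintegral_indicator_one, hA, hB, hC] using this
  · intro x y
    by_cases hx : x ∈ A
    · by_cases hy : y ∈ B
      · simp [hx, hy, h x hx y hy]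
      · simp [hy, ht]
    · simp [hx, hs]

open Pointwise in
/-- If `|A| ≤ ρⁿ|W|`, then adding `ε • W` to `A` increases the measure by a factor
at least `1 + nε/ρ`. -/
theorem brunn_minkowski_dilation {n : ℕ} {A W C : Set (Fin n → ℝ)} (hA : MeasurableSet A)
    (hW : MeasurableSet W) (hC : MeasurableSet C) (hWpos : volume W ≠ 0) (hWfin : volume W ≠ ∞)
    {ρ ε : ℝ} (hρ : 0 < ρ) (hε : 0 < ε)
    (hAρ : volume A ≤ ENNReal.ofReal (ρ ^ n) * volume W) (h : ∀ x ∈ A, ∀ y ∈ W, x + ε • y ∈ C) :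
    ENNReal.ofReal (1 + n * ε / ρ) * volume A ≤ volume C := by
  have hAfin : volume A ≠ ∞ := (hAρ.trans_lt (ENNReal.mul_lt_top ofReal_lt_top hWfin.lt_top)).ne
  by_cases hA0 : volume A = 0
  · simp [hA0]
  rcases Nat.eq_zero_or_pos n with hn | hn
  · subst hn
    obtain ⟨y, hy⟩ := nonempty_of_measure_ne_zero hWpos
    simp only [Nat.cast_zero, zero_mul, zero_div, add_zero, ENNReal.ofReal_one, one_mul]
    refine measure_mono fun x hx => ?_
    have := h x hx y hy
    rwa [Subsingleton.elim (x + ε • y) x] at this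
  -- write `|A| = aⁿ |W|`
  obtain ⟨a, ha0, ha⟩ : ∃ a : ℝ, 0 < a ∧ volume A = ENNReal.ofReal (a ^ n) * volume W := by
    have hq : 0 < (volume A).toReal / (volume W).toReal :=
      div_pos (toReal_pos hA0 hAfin) (toReal_pos hWpos hWfin)
    refine ⟨((volume A).toReal / (volume W).toReal) ^ ((n : ℝ)⁻¹), by positivity, ?_⟩
    rw [Real.rpow_inv_natCast_pow hq.le hn.ne', ENNReal.ofReal_div_of_pos (toReal_pos hWpos hWfin),
      ENNReal.ofReal_toReal hAfin, ENNReal.ofReal_toReal hWfin,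
      ENNReal.div_mul_cancel hWpos hWfin]
  have haρ : a ≤ ρ := by
    rw [ha, ENNReal.mul_le_mul_iff_left hWpos hWfin,
      ENNReal.ofReal_le_ofReal_iff (by positivity)] at hAρ
    exact le_of_pow_le_pow_left₀ hn.ne' hρ.le hAρ
  have hsc : ∀ {r : ℝ} (_ : 0 < r) (S : Set (Fin n → ℝ)),
      volume (r⁻¹ • S) = ENNReal.ofReal ((r ^ n)⁻¹) * volume S := by
    intro r hr S
    rw [Measure.addHaar_smul]
    congr 2
    simp [abs_of_pos hr]
  have hsum : 0 < a + ε := by positivity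
  have key := brunn_minkowski_rpow (A := a⁻¹ • A) (B := W) (C := (a + ε)⁻¹ • C)
    (hA.const_smul_of_ne_zero (by positivity)) hW (hC.const_smul_of_ne_zero (by positivity))
    (s := a / (a + ε)) (t := ε / (a + ε)) (by positivity) (by positivity) (by field_simp) ?_
  · rw [hsc ha0, hsc hsum, ha, ← mul_assoc, ← ENNReal.ofReal_mul (by positivity),
      inv_mul_cancel₀ (by positivity), ENNReal.ofReal_one, one_mul,
      ← ENNReal.rpow_add _ _ hWpos hWfin, show a / (a + ε) + ε / (a + ε) = 1 by field_simp,
      ENNReal.rpow_one] at key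
    have h2 : ENNReal.ofReal ((a + ε) ^ n) * volume W ≤ volume C := by
      calc _ ≤ ENNReal.ofReal ((a + ε) ^ n) * (ENNReal.ofReal (((a + ε) ^ n)⁻¹) * volume C) := by
            gcongr
        _ = volume C := by
            rw [← mul_assoc, ← ENNReal.ofReal_mul (by positivity),
              mul_inv_cancel₀ (by positivity), ENNReal.ofReal_one, one_mul]
    refine le_trans ?_ h2
    rw [ha, ← mul_assoc, ← ENNReal.ofReal_mul (by positivity)]
    gcongr
    have hb := one_add_mul_le_pow (a := ε / a) (by have : 0 < ε / a := by positivity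
                                                   linarith) n
    calc (1 + n * ε / ρ) * a ^ n ≤ (1 + ε / a) ^ n * a ^ n := by
          gcongr
          refine le_trans ?_ hb
          rw [mul_div_assoc]
          gcongr
      _ = (a + ε) ^ n := by
          rw [← mul_pow]; congr 1; field_simp
  · rintro _ ⟨x, hx, rfl⟩ y hy
    refine ⟨x + ε • y, h x hx y hy, ?_⟩
    simp only [smul_add, smul_smul]
    congr 2 
    · field_simp
    · field_simp

namespace IsNorm

variable {n : ℕ} {φ : (Fin n → ℝ) → ℝ}

theorem map_zero (hφ : IsNorm φ) : φ 0 = 0 := (hφ.eq_zero_iff 0).2 rfl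

theorem map_neg (hφ : IsNorm φ) (x : Fin n → ℝ) : φ (-x) = φ x := by
  simpa using hφ.smul_eq (-1) x

theorem abs_sub_le (hφ : IsNorm φ) (x y : Fin n → ℝ) : |φ x - φ y| ≤ φ (x - y) := by
  have h1 := hφ.add_le (x - y) y
  have h2 := hφ.add_le (y - x) x
  rw [sub_add_cancel] at h1 h2
  rw [← neg_sub, hφ.map_neg] at h2
  exact abs_le.2 ⟨by linarith, by linarith⟩

theorem exists_le_mul_norm (hφ : IsNorm φ) : ∃ C : ℝ, 0 < C ∧ ∀ x, φ x ≤ C * ‖x‖ := by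
  have key : ∀ (s : Finset (Fin n)) (g : Fin n → (Fin n → ℝ)),
      φ (∑ i ∈ s, g i) ≤ ∑ i ∈ s, φ (g i) := by
    intro s g
    induction s using Finset.induction_on with
    | empty => simp [hφ.map_zero]
    | insert a s ha ih =>
      rw [Finset.sum_insert ha, Finset.sum_insert ha]
      exact (hφ.add_le _ _).trans (by gcongr)
  refine ⟨∑ i, φ (Pi.single i 1) + 1, ?_, fun x => ?_⟩
  · exact add_pos_of_nonneg_of_pos (Finset.sum_nonneg fun i _ => hφ.nonneg _) zero_lt_one
  · have hx : x = ∑ i, x i • (Pi.single i 1 : Fin n → ℝ) := by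
      ext j; simp [Finset.sum_apply, Pi.single_apply]
    calc φ x ≤ ∑ i, φ (x i • (Pi.single i 1 : Fin n → ℝ)) := by
          conv_lhs => rw [hx]
          exact key _ _
      _ = ∑ i, |x i| * φ (Pi.single i 1) := by simp [hφ.smul_eq]
      _ ≤ ∑ i, ‖x‖ * φ (Pi.single i 1) := by
          gcongr with i
          · exact hφ.nonneg _
          · exact norm_le_pi_norm x i
      _ ≤ (∑ i, φ (Pi.single i 1) + 1) * ‖x‖ := by
          rw [← Finset.mul_sum]
          nlinarith [norm_nonneg x]

theorem exists_lipschitzWith (hφ : IsNorm φ) : ∃ C : NNReal, LipschitzWith C φ := by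
  obtain ⟨C, hC0, hC⟩ := hφ.exists_le_mul_norm
  refine ⟨⟨C, hC0.le⟩, LipschitzWith.of_dist_le_mul fun x y => ?_⟩
  rw [Real.dist_eq, dist_eq_norm]
  exact (hφ.abs_sub_le x y).trans (hC _)

theorem continuous (hφ : IsNorm φ) : Continuous φ :=
  let ⟨_, h⟩ := hφ.exists_lipschitzWith
  h.continuous

theorem exists_norm_le_mul (hφ : IsNorm φ) : ∃ C : ℝ, 0 < C ∧ ∀ x, ‖x‖ ≤ C * φ x := by
  rcases (Metric.sphere (0 : Fin n → ℝ) 1).eq_empty_or_nonempty with h | h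
  · refine ⟨1, one_pos, fun x => ?_⟩
    by_cases hx : x = 0
    · simp [hx, hφ.map_zero]
    · have : ‖x‖⁻¹ • x ∈ Metric.sphere (0 : Fin n → ℝ) 1 := by
        simp [norm_smul, hx]
      simp [h] at this
  · obtain ⟨x₀, hx₀, hmin⟩ := (isCompact_sphere (0 : Fin n → ℝ) 1).exists_isMinOn h
      hφ.continuous.continuousOn
    have hpos : 0 < φ x₀ := by
      refine (hφ.nonneg _).lt_of_ne' fun h0 => ?_
      rw [hφ.eq_zero_iff] at h0
      simp [h0] at hx₀
    refine ⟨(φ x₀)⁻¹, inv_pos.2 hpos, fun x => ?_⟩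
    by_cases hx : x = 0
    · simp [hx, hφ.map_zero]
    · have hx' : 0 < ‖x‖ := norm_pos_iff.2 hx
      have hmem : ‖x‖⁻¹ • x ∈ Metric.sphere (0 : Fin n → ℝ) 1 := by
        simp [norm_smul, hx]
      have := hmin hmem
      simp only [mem_ofPred_eq, hφ.smul_eq, abs_inv, abs_norm] at this
      rw [inv_mul_eq_div, le_div_iff₀ hpos]
      rwa [inv_mul_eq_div, le_div_iff₀ hx', mul_comm] at this

theorem convex_le (hφ : IsNorm φ) (r : ℝ) : Convex ℝ {x | φ x ≤ r} := by
  intro x hx y hy a b ha hb hab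
  have hx : φ x ≤ r := hx
  have hy : φ y ≤ r := hy
  refine (hφ.add_le _ _).trans ?_
  rw [hφ.smul_eq, hφ.smul_eq, abs_of_nonneg ha, abs_of_nonneg hb]
  calc a * φ x + b * φ y ≤ a * r + b * r := by gcongr
    _ = r := by rw [← add_mul, hab, one_mul]

theorem isOpen_wulffBall (hφ : IsNorm φ) (x : Fin n → ℝ) (r : ℝ) : IsOpen (wulffBall φ x r) :=
  isOpen_lt (hφ.continuous.comp (by fun_prop)) continuous_const

theorem isCompact_le (hφ : IsNorm φ) (r : ℝ) : IsCompact {x | φ x ≤ r} := by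
  obtain ⟨C, hC, h⟩ := hφ.exists_norm_le_mul
  refine Metric.isCompact_of_isClosed_isBounded (isClosed_le hφ.continuous continuous_const) ?_
  refine (Metric.isBounded_closedBall (x := (0 : Fin n → ℝ)) (r := C * r)).subset fun x hx => ?_
  rw [mem_closedBall_zero_iff]
  exact (h x).trans (by gcongr; exact hx)

open Pointwise in
theorem volume_wulffBall (hφ : IsNorm φ) (x : Fin n → ℝ) {r : ℝ} (hr : 0 < r) :
    volume (wulffBall φ x r) = ENNReal.ofReal (r ^ n) * volume (wulffBall φ 0 1) := by
  have h1 : wulffBall φ x r = (fun y => y + (-x)) ⁻¹' (r • wulffBall φ 0 1) := by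
    ext y
    simp only [wulffBall, mem_ofPred_eq, mem_preimage, mem_smul_set_iff_inv_smul_mem₀ hr.ne',
      hφ.smul_eq, sub_zero, abs_inv, abs_of_pos hr, ← sub_eq_add_neg]
    rw [inv_mul_eq_div, div_lt_one hr]
  rw [h1, measure_preimage_add_right, Measure.addHaar_smul]
  simp [abs_of_pos hr]

theorem volume_wulffBall_ne_zero (hφ : IsNorm φ) (x : Fin n → ℝ) {r : ℝ} (hr : 0 < r) :
    volume (wulffBall φ x r) ≠ 0 :=
  ((hφ.isOpen_wulffBall x r).measure_pos volume ⟨x, by simp [wulffBall, hφ.map_zero, hr]⟩).ne'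

theorem volume_wulffBall_ne_top (hφ : IsNorm φ) : volume (wulffBall φ 0 1) ≠ ∞ := by
  refine ((measure_mono ?_).trans_lt (hφ.isCompact_le 1).measure_lt_top).ne
  intro x hx
  have : φ (x - 0) < 1 := hx
  rw [sub_zero] at this
  exact this.le

end IsNorm

/-- The dual norm `φ*` on linear functionals. -/
def dualNorm {n : ℕ} (φ : (Fin n → ℝ) → ℝ) (L : (Fin n → ℝ) →L[ℝ] ℝ) : ℝ :=
  sSup (L '' {x | φ x ≤ 1})

namespace IsNorm

variable {n : ℕ} {φ : (Fin n → ℝ) → ℝ}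

theorem exists_apply_eq_dualNorm (hφ : IsNorm φ) (L : (Fin n → ℝ) →L[ℝ] ℝ) :
    ∃ x, φ x ≤ 1 ∧ L x = dualNorm φ L := by
  obtain ⟨x, hx, h⟩ := ((hφ.isCompact_le 1).image L.continuous).sSup_mem
    ⟨L 0, 0, by simp [hφ.map_zero], rfl⟩
  exact ⟨x, hx, h⟩

theorem apply_le_dualNorm (hφ : IsNorm φ) (L : (Fin n → ℝ) →L[ℝ] ℝ) {x : Fin n → ℝ}
    (hx : φ x ≤ 1) : L x ≤ dualNorm φ L :=
  le_csSup ((hφ.isCompact_le 1).image L.continuous).bddAbove ⟨x, hx, rfl⟩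

theorem dualNorm_nonneg (hφ : IsNorm φ) (L : (Fin n → ℝ) →L[ℝ] ℝ) : 0 ≤ dualNorm φ L := by
  simpa using hφ.apply_le_dualNorm L (x := 0) (by simp [hφ.map_zero])

theorem exists_lipschitzWith_dualNorm (hφ : IsNorm φ) :
    ∃ C : NNReal, LipschitzWith C (dualNorm φ) := by
  obtain ⟨C, hC, h⟩ := hφ.exists_norm_le_mul
  refine ⟨⟨C, hC.le⟩, LipschitzWith.of_le_add_mul _ fun L M => ?_⟩
  obtain ⟨x, hx, hLx⟩ := hφ.exists_apply_eq_dualNorm L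
  have h1 := hφ.apply_le_dualNorm M hx
  have h2 : (L - M) x ≤ ‖L - M‖ * C :=
    (le_abs_self _).trans (((L - M).le_opNorm x).trans (by
      gcongr
      exact (h x).trans (by nlinarith)))
  rw [dist_eq_norm, ← hLx]
  simp only [sub_apply] at h2
  change L x ≤ dualNorm φ M + C * _
  linarith

theorem continuous_dualNorm (hφ : IsNorm φ) : Continuous (dualNorm φ) :=
  let ⟨_, h⟩ := hφ.exists_lipschitzWith_dualNorm
  h.continuous

end IsNorm

/-- The admissible fields in the definition of the anisotropic total variation. -/
structure IsTestField {n : ℕ} (φ : (Fin n → ℝ) → ℝ) (η : (Fin n → ℝ) → (Fin n → ℝ)) : Prop where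
  contDiff : ContDiff ℝ 1 η
  hasCompactSupport : HasCompactSupport η
  le_one : ∀ x, φ (η x) ≤ 1

section TotalVariation

variable {n : ℕ} {φ : (Fin n → ℝ) → ℝ} {η : (Fin n → ℝ) → (Fin n → ℝ)}
  {u v : (Fin n → ℝ) → ℝ}

theorem continuous_diverg (hη : ContDiff ℝ 1 η) : Continuous (diverg η) := by
  have := hη.continuous_fderiv one_ne_zero
  unfold diverg
  fun_prop

theorem hasCompactSupport_diverg (hη : HasCompactSupport η) : HasCompactSupport (diverg η) := by
  refine hη.mono' fun x hx => ?_
  by_contra h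
  exact hx (by simp [diverg, fderiv_of_notMem_tsupport (𝕜 := ℝ) h])

theorem exists_abs_diverg_le (hη : ContDiff ℝ 1 η) (hc : HasCompactSupport η) :
    ∃ C : ℝ, 0 < C ∧ ∀ x, |diverg η x| ≤ C := by
  obtain ⟨C, hC⟩ := (continuous_diverg hη).bounded_above_of_compact_support
    (hasCompactSupport_diverg hc)
  exact ⟨max C 1, by positivity, fun x => (hC x).trans (le_max_left _ _)⟩

theorem integrable_mul_diverg (hu : Integrable u) (hη : ContDiff ℝ 1 η)
    (hc : HasCompactSupport η) : Integrable fun x => u x * diverg η x := by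
  obtain ⟨C, -, hC⟩ := exists_abs_diverg_le hη hc
  exact hu.mul_bdd (continuous_diverg hη).aestronglyMeasurable (Eventually.of_forall hC)

theorem IsTestField.ofReal_integral_le (hη : IsTestField φ η) (u : (Fin n → ℝ) → ℝ) :
    ENNReal.ofReal (∫ x, u x * diverg η x) ≤ anisoTV φ u :=
  le_iSup₂_of_le η ⟨hη.1, hη.2, hη.3⟩ le_rfl

theorem IsTestField.integral_le (hη : IsTestField φ η) (hu : anisoTV φ u ≠ ∞) :
    ∫ x, u x * diverg η x ≤ (anisoTV φ u).toReal :=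
  (ENNReal.ofReal_le_iff_le_toReal hu).1 (hη.ofReal_integral_le u)

theorem anisoTV_le {c : ℝ} (h : ∀ η, IsTestField φ η → ∫ x, u x * diverg η x ≤ c) :
    anisoTV φ u ≤ ENNReal.ofReal c :=
  iSup₂_le fun _ hη => ENNReal.ofReal_le_ofReal (h _ ⟨hη.1, hη.2.1, hη.2.2⟩)

theorem anisoTV_add_le (hu : Integrable u) (hv : Integrable v) :
    anisoTV φ (fun x => u x + v x) ≤ anisoTV φ u + anisoTV φ v := by
  refine iSup₂_le fun η hη => ?_
  have hη : IsTestField φ η := ⟨hη.1, hη.2.1, hη.2.2⟩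
  simp only [add_mul]
  rw [integral_add (integrable_mul_diverg hu hη.1 hη.2) (integrable_mul_diverg hv hη.1 hη.2)]
  exact ENNReal.ofReal_add_le.trans
    (add_le_add (hη.ofReal_integral_le u) (hη.ofReal_integral_le v))

/-- Integration by parts of a Lipschitz function against a compactly supported `C¹` field. -/
theorem integral_mul_diverg_eq {C : NNReal} {g : (Fin n → ℝ) → ℝ} (hg : LipschitzWith C g)
    (hη : ContDiff ℝ 1 η) (hc : HasCompactSupport η) :
    Integrable (fun x => fderiv ℝ g x (η x)) ∧
      ∫ x, g x * diverg η x = - ∫ x, fderiv ℝ g x (η x) := by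
  obtain ⟨D, hD⟩ := hη.lipschitzWith_of_hasCompactSupport hc one_ne_zero
  have hcomp : ∀ i, LipschitzWith D fun x => η x i := fun i => by
    simpa [Function.comp_def] using (LipschitzWith.eval (α := fun _ : Fin n => ℝ) i).comp hD
  have hci : ∀ i, HasCompactSupport fun x => η x i := fun i =>
    hc.comp_left (g := fun y : Fin n → ℝ => y i) rfl
  have hdiff : ∀ᵐ x, DifferentiableAt ℝ g x := hg.ae_differentiableAt
  have hint : ∀ i, Integrable fun x => lineDeriv ℝ g x (Pi.single i 1) * η x i := fun i => by
    have h1 : Integrable fun x => η x i :=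
      (hcomp i).continuous.integrable_of_hasCompactSupport (hci i)
    exact h1.bdd_mul (aestronglyMeasurable_lineDeriv hg.continuous volume)
      (Eventually.of_forall fun x => norm_lineDeriv_le_of_lipschitz ℝ hg)
  have hsum : (fun x => fderiv ℝ g x (η x)) =ᵐ[volume]
      fun x => ∑ i, lineDeriv ℝ g x (Pi.single i 1) * η x i := by
    filter_upwards [hdiff] with x hx
    have hx' : η x = ∑ i, η x i • (Pi.single i 1 : Fin n → ℝ) := by
      ext j; simp [Finset.sum_apply, Pi.single_apply]
    conv_lhs => rw [hx', map_sum]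
    refine Finset.sum_congr rfl fun i _ => ?_
    rw [hx.lineDeriv_eq_fderiv, map_smul, smul_eq_mul, mul_comm]
  refine ⟨(integrable_finsetSum _ fun i _ => hint i).congr hsum.symm, ?_⟩
  rw [integral_congr_ae hsum, integral_finsetSum _ fun i _ => hint i, ← Finset.sum_neg_distrib]
  have hd : ∀ x, DifferentiableAt ℝ η x := fun x => hη.differentiable one_ne_zero x
  have hline : ∀ i x, lineDeriv ℝ (fun x => η x i) x (-Pi.single i 1) =
      - fderiv ℝ η x (Pi.single i 1) i := by
    intro i x
    rw [lineDeriv_neg, DifferentiableAt.lineDeriv_eq_fderiv (differentiableAt_pi.1 (hd x) i),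
      fderiv_apply (hd x)]
    rfl
  have hint2 : ∀ i, Integrable fun x => g x * fderiv ℝ η x (Pi.single i 1) i := by
    intro i
    have hcont : Continuous fun x => fderiv ℝ η x := hη.continuous_fderiv one_ne_zero
    refine Continuous.integrable_of_hasCompactSupport
      (by have := hg.continuous; fun_prop) ?_
    refine hc.mono' fun x hx => ?_
    by_contra h
    exact hx (by simp [fderiv_of_notMem_tsupport (𝕜 := ℝ) h])
  simp only [diverg, Finset.mul_sum]
  rw [integral_finsetSum _ fun i _ => hint2 i]
  refine Finset.sum_congr rfl fun i _ => ?_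
  rw [hg.integral_lineDeriv_mul_eq (hcomp i) (hci i), ← integral_neg]
  congr 1; ext x
  rw [hline]; ring

end TotalVariation

section Smooth

variable {n : ℕ} {φ : (Fin n → ℝ) → ℝ}

open scoped Manifold in
/-- A `C¹` field which almost attains the dual norm of a continuous field of functionals. -/
theorem IsNorm.exists_contDiff_dualNorm_sub_lt (hφ : IsNorm φ)
    {L : (Fin n → ℝ) → (Fin n → ℝ) →L[ℝ] ℝ} (hL : Continuous L) {κ : ℝ} (hκ : 0 < κ) :
    ∃ ξ : (Fin n → ℝ) → (Fin n → ℝ), ContDiff ℝ 1 ξ ∧ ∀ x, φ (ξ x) ≤ 1 ∧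
      dualNorm φ (L x) - κ < L x (ξ x) := by
  obtain ⟨g, hg⟩ := exists_contMDiffMap_forall_mem_convex_of_local_const (n := 1)
    (I := 𝓘(ℝ, Fin n → ℝ)) (M := Fin n → ℝ) (F := Fin n → ℝ)
    (t := fun x => {ξ | φ ξ ≤ 1} ∩ {ξ | dualNorm φ (L x) - κ < L x ξ})
    (fun x => (hφ.convex_le 1).inter (convex_halfSpace_gt (L x).isLinear _)) (fun x => by
      obtain ⟨c, hc, hLc⟩ := hφ.exists_apply_eq_dualNorm (L x)
      refine ⟨c, ?_⟩
      have hcont1 : Continuous fun y => dualNorm φ (L y) - κ :=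
        (hφ.continuous_dualNorm.comp hL).sub continuous_const
      have hcont2 : Continuous fun y => L y c := by fun_prop
      filter_upwards [(isOpen_lt hcont1 hcont2).mem_nhds
        (show dualNorm φ (L x) - κ < L x c by rw [hLc]; linarith)] with y hy
      exact ⟨hc, hy⟩)
  exact ⟨g, contMDiff_iff_contDiff.1 g.contMDiff, fun x => hg x⟩

/-- The integral of the dual norm of the gradient is at most the total variation. -/
theorem lintegral_dualNorm_fderiv_le (hφ : IsNorm φ) {C : NNReal} {f : (Fin n → ℝ) → ℝ}
    (hf : LipschitzWith C f) (hf' : Continuous (fderiv ℝ f)) :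
    ∫⁻ x, ENNReal.ofReal (dualNorm φ (fderiv ℝ f x)) ≤ anisoTV φ f := by
  by_cases hTV : anisoTV φ f = ∞
  · simp [hTV]
  set G : (Fin n → ℝ) → ℝ := fun x => dualNorm φ (fderiv ℝ f x) with hG
  have hGc : Continuous G := hφ.continuous_dualNorm.comp hf'
  have hG0 : ∀ x, 0 ≤ G x := fun x => hφ.dualNorm_nonneg _
  have key : ∀ χ : ContDiffBump (0 : Fin n → ℝ), ∫ x, χ x * G x ≤ (anisoTV φ f).toReal := by
    intro χ
    have hχG : Integrable fun x => χ x * G x :=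
      (χ.continuous.mul hGc).integrable_of_hasCompactSupport χ.hasCompactSupport.mul_right
    refine le_of_forall_pos_le_add fun e he => ?_
    set I := ∫ x, χ x
    have hI : 0 ≤ I := integral_nonneg fun x => χ.nonneg
    obtain ⟨ξ, hξ, hξ1⟩ := hφ.exists_contDiff_dualNorm_sub_lt hf' (κ := e / (I + 1)) (by positivity)
    have htest : IsTestField φ fun x => -(χ x • ξ x) := by
      refine ⟨(χ.contDiff.smul hξ).neg, ?_, fun x => ?_⟩
      · exact χ.hasCompactSupport.smul_right.neg
      · rw [hφ.map_neg, hφ.smul_eq, abs_of_nonneg χ.nonneg]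
        exact mul_le_one₀ χ.le_one (hφ.nonneg _) (hξ1 x).1
    have h1 := htest.integral_le hTV
    obtain ⟨hi, heq⟩ := integral_mul_diverg_eq hf htest.1 htest.2
    rw [heq, ← integral_neg] at h1
    have h2 : ∫ x, (χ x * G x - e / (I + 1) * χ x) ≤
        ∫ x, -(fderiv ℝ f x) (-(χ x • ξ x)) := by
      refine integral_mono (hχG.sub (χ.integrable.const_mul _)) hi.neg fun x => ?_
      simp only [map_neg, neg_neg, map_smul, smul_eq_mul]
      have := (hξ1 x).2
      have := mul_le_mul_of_nonneg_left this.le (χ.nonneg (x := x))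
      simp only [hG]
      linarith
    rw [integral_sub hχG (χ.integrable.const_mul _), integral_const_mul] at h2
    have h3 : e / (I + 1) * I ≤ e := by
      rw [div_mul_eq_mul_div, div_le_iff₀ (by positivity)]
      nlinarith
    change _ - e / (I + 1) * I ≤ _ at h2
    linarith
  have hU : (⋃ k : ℕ, Metric.closedBall (0 : Fin n → ℝ) ((k : ℝ) + 1)) = univ := by
    refine eq_univ_of_forall fun x => mem_iUnion.2 ?_
    obtain ⟨k, hk⟩ := exists_nat_ge ‖x‖
    exact ⟨k, by rw [mem_closedBall_zero_iff]; linarith⟩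
  rw [← setLIntegral_univ, ← hU, setLIntegral_iUnion_of_directed]
  · refine iSup_le fun k => ?_
    let χ : ContDiffBump (0 : Fin n → ℝ) := ⟨k + 1, k + 2, by positivity, by linarith⟩
    rw [← lintegral_indicator measurableSet_closedBall]
    calc _ ≤ ∫⁻ x, ENNReal.ofReal (χ x * G x) := by
          refine lintegral_mono fun x => ?_
          by_cases hx : x ∈ Metric.closedBall (0 : Fin n → ℝ) ((k : ℝ) + 1)
          · rw [indicator_of_mem hx, χ.one_of_mem_closedBall hx, one_mul]
          · rw [indicator_of_notMem hx]; exact zero_le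
      _ = ENNReal.ofReal (∫ x, χ x * G x) := by
          rw [ofReal_integral_eq_lintegral_ofReal]
          · exact (χ.continuous.mul hGc).integrable_of_hasCompactSupport
              χ.hasCompactSupport.mul_right
          · exact Eventually.of_forall fun x => mul_nonneg χ.nonneg (hG0 x)
      _ ≤ anisoTV φ f := (ENNReal.ofReal_le_iff_le_toReal hTV).2 (key χ)
  · refine Monotone.directed_le fun i j hij => Metric.closedBall_subset_closedBall ?_
    have : (i : ℝ) ≤ j := by exact_mod_cast hij
    linarith

end Smooth

section Mollification

variable {n : ℕ} {φ : (Fin n → ℝ) → ℝ}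

open Convolution ContinuousLinearMap in
/-- The mollification of a function by a normed bump function. -/
def mollify (ρ : ContDiffBump (0 : Fin n → ℝ)) (u : (Fin n → ℝ) → ℝ) : (Fin n → ℝ) → ℝ :=
  (ρ.normed volume ⋆[lsmul ℝ ℝ, volume] u)

variable (ρ : ContDiffBump (0 : Fin n → ℝ)) {u : (Fin n → ℝ) → ℝ}

theorem mollify_apply (u : (Fin n → ℝ) → ℝ) (x : Fin n → ℝ) :
    mollify ρ u x = ∫ t, ρ.normed volume (x - t) * u t := by
  simp [mollify, convolution_eq_swap]

theorem integrable_mollify (hu : Integrable u) : Integrable (mollify ρ u) :=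
  ρ.integrable_normed.integrable_convolution _ hu

theorem mollify_nonneg (hu : 0 ≤ᵐ[volume] u) (x : Fin n → ℝ) : 0 ≤ mollify ρ u x := by
  rw [mollify_apply]
  refine integral_nonneg_of_ae ?_
  filter_upwards [hu] with t ht
  exact mul_nonneg (ρ.nonneg_normed _) ht

theorem integral_mollify (hu : Integrable u) : ∫ x, mollify ρ u x = ∫ x, u x := by
  have := integral_convolution (ContinuousLinearMap.lsmul ℝ ℝ) ρ.integrable_normed hu
    (μ := (volume : Measure (Fin n → ℝ))) (ν := (volume : Measure (Fin n → ℝ)))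
  rw [mollify, this, ρ.integral_normed]
  simp

theorem integrable_normed_sub_mul (hu : Integrable u) (x : Fin n → ℝ) :
    Integrable fun t => ρ.normed volume (x - t) * u t := by
  obtain ⟨C, hC⟩ := ρ.continuous_normed (μ := volume).bounded_above_of_compact_support
    ρ.hasCompactSupport_normed
  exact hu.bdd_mul (ρ.continuous_normed.comp (by fun_prop)).aestronglyMeasurable
    (Eventually.of_forall fun t => hC _)

theorem exists_lipschitzWith_mollify (hu : Integrable u) :
    ∃ C : NNReal, LipschitzWith C (mollify ρ u) := by
  obtain ⟨D, hD⟩ := (ρ.contDiff_normed (μ := volume) (n := 1)).lipschitzWith_of_hasCompactSupport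
    ρ.hasCompactSupport_normed one_ne_zero
  refine ⟨D * Real.toNNReal (∫ t, ‖u t‖), LipschitzWith.of_dist_le_mul fun x y => ?_⟩
  have h0 : 0 ≤ ∫ t, ‖u t‖ := integral_nonneg fun t => norm_nonneg _
  rw [NNReal.coe_mul, Real.coe_toNNReal _ h0, dist_eq_norm, mollify_apply, mollify_apply,
    ← integral_sub (integrable_normed_sub_mul ρ hu x) (integrable_normed_sub_mul ρ hu y),
    mul_right_comm, ← integral_const_mul]
  refine norm_integral_le_of_norm_le (hu.norm.const_mul _) (Eventually.of_forall fun t => ?_)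
  rw [← sub_mul, norm_mul]
  gcongr
  have := hD.dist_le_mul (x - t) (y - t)
  rwa [dist_eq_norm, dist_sub_right] at this

/-- The mollification is differentiable with continuous derivative, with a Taylor expansion that is
uniform in the base point. -/
theorem mollify_taylor (hu : Integrable u) : Continuous (fderiv ℝ (mollify ρ u)) ∧
    ∃ K : ℝ, 0 ≤ K ∧ ∀ x y, |mollify ρ u (x + y) - mollify ρ u x - fderiv ℝ (mollify ρ u) x y| ≤
      K * ‖y‖ ^ 2 := by
  set r : (Fin n → ℝ) → ℝ := ρ.normed volume with hr
  have hr2 : ContDiff ℝ 2 r := ρ.contDiff_normed (n := 2)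
  have hr1 : ContDiff ℝ 1 (fderiv ℝ r) := hr2.fderiv_right (by norm_num)
  have hd : ∀ x, DifferentiableAt ℝ r x := fun x => hr2.differentiable two_ne_zero x
  have hcs : HasCompactSupport (fderiv ℝ r) := ρ.hasCompactSupport_normed.fderiv ℝ
  obtain ⟨D, hD⟩ := hr1.lipschitzWith_of_hasCompactSupport hcs one_ne_zero
  have hT : ∀ a y, |r (a + y) - r a - fderiv ℝ r a y| ≤ D * ‖y‖ ^ 2 := by
    intro a y
    have := (convex_closedBall a ‖y‖).norm_image_sub_le_of_norm_fderiv_le' (𝕜 := ℝ) (f := r)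
      (C := D * ‖y‖) (φ := fderiv ℝ r a) (x := a) (y := a + y) (fun z _ => hd z) (fun z hz => ?_)
      (by simp) (by simp)
    · simpa [pow_two, mul_assoc] using this
    · refine (dist_eq_norm (fderiv ℝ r z) (fderiv ℝ r a) ▸ hD.dist_le_mul z a).trans ?_
      gcongr
      exact hz
  obtain ⟨M, hM⟩ := hr1.continuous.bounded_above_of_compact_support hcs
  have hint : ∀ x, Integrable fun t => u t • fderiv ℝ r (x - t) := fun x =>
    hu.smul_bdd M (hr1.continuous.comp (by fun_prop)).aestronglyMeasurable
      (Eventually.of_forall fun t => hM _)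
  set K : ℝ := ∫ t, D * ‖u t‖ with hK
  have hK0 : 0 ≤ K := integral_nonneg fun t => by positivity
  set L : (Fin n → ℝ) → (Fin n → ℝ) →L[ℝ] ℝ := fun x => ∫ t, u t • fderiv ℝ r (x - t) with hL
  have hmain : ∀ x y, |mollify ρ u (x + y) - mollify ρ u x - L x y| ≤ K * ‖y‖ ^ 2 := by
    intro x y
    have hLy : L x y = ∫ t, u t * fderiv ℝ r (x - t) y := by
      rw [hL, ContinuousLinearMap.integral_apply (hint x)]
      simp
    have hi3 : Integrable fun t => u t * fderiv ℝ r (x - t) y := by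
      simpa using (hint x).apply_continuousLinearMap y
    have hi12 : Integrable fun t =>
        ρ.normed volume (x + y - t) * u t - ρ.normed volume (x - t) * u t :=
      (integrable_normed_sub_mul ρ hu _).sub (integrable_normed_sub_mul ρ hu _)
    rw [hLy, mollify_apply, mollify_apply,
      ← integral_sub (integrable_normed_sub_mul ρ hu _) (integrable_normed_sub_mul ρ hu _),
      ← integral_sub hi12 hi3, ← Real.norm_eq_abs, hK, ← integral_mul_const]
    refine norm_integral_le_of_norm_le ((hu.norm.const_mul _).mul_const _)
      (Eventually.of_forall fun t => ?_)
    have h := hT (x - t) y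
    rw [← hr, show x + y - t = x - t + y by abel,
      show r (x - t + y) * u t - r (x - t) * u t - u t * fderiv ℝ r (x - t) y =
        (r (x - t + y) - r (x - t) - fderiv ℝ r (x - t) y) * u t by ring, norm_mul,
      Real.norm_eq_abs]
    calc _ ≤ D * ‖y‖ ^ 2 * ‖u t‖ := by gcongr
      _ = _ := by ring
  have hderiv : ∀ x, HasFDerivAt (mollify ρ u) (L x) x := by
    intro x
    rw [hasFDerivAt_iff_isLittleO_nhds_zero]
    have hO : (fun h => mollify ρ u (x + h) - mollify ρ u x - L x h) =O[nhds 0]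
        fun h => ‖h‖ ^ 2 :=
      Asymptotics.IsBigO.of_bound K (Eventually.of_forall fun h => by
        simpa using hmain x h)
    refine hO.trans_isLittleO ?_
    exact Asymptotics.isLittleO_norm_pow_id one_lt_two
  have hfd : fderiv ℝ (mollify ρ u) = L := funext fun x => (hderiv x).fderiv
  refine ⟨?_, K, hK0, fun x y => by rw [hfd]; exact hmain x y⟩
  rw [hfd]
  refine LipschitzWith.continuous (K := Real.toNNReal K) (LipschitzWith.of_dist_le_mul
    fun x y => ?_)
  rw [Real.coe_toNNReal _ hK0, dist_eq_norm, hL, ← integral_sub (hint x) (hint y), hK,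
    ← integral_mul_const]
  refine norm_integral_le_of_norm_le ((hu.norm.const_mul _).mul_const _)
    (Eventually.of_forall fun t => ?_)
  rw [← smul_sub (u t) (fderiv ℝ r (x - t)) (fderiv ℝ r (y - t)), norm_smul, mul_comm,
    mul_right_comm]
  gcongr
  have := hD.dist_le_mul (x - t) (y - t)
  rwa [dist_eq_norm, dist_sub_right] at this

theorem anisoTV_mollify_le (hu : Integrable u) : anisoTV φ (mollify ρ u) ≤ anisoTV φ u := by
  by_cases hTV : anisoTV φ u = ∞
  · simp [hTV]
  rw [← ENNReal.ofReal_toReal hTV]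
  refine anisoTV_le fun η hη => ?_
  have hprod : Integrable (Function.uncurry fun x t : Fin n → ℝ =>
      ρ.normed volume t * u (x - t) * diverg η x) (volume.prod volume) := by
    obtain ⟨C, -, hC⟩ := exists_abs_diverg_le hη.1 hη.2
    have := ρ.integrable_normed.convolution_integrand (ContinuousLinearMap.lsmul ℝ ℝ) hu
      (μ := (volume : Measure (Fin n → ℝ))) (ν := (volume : Measure (Fin n → ℝ)))
    refine this.mul_bdd (c := C) ?_ (Eventually.of_forall fun p => hC _)
    exact ((continuous_diverg hη.1).comp continuous_fst).aestronglyMeasurable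
  have e1 : ∀ x, mollify ρ u x * diverg η x =
      ∫ t, ρ.normed volume t * u (x - t) * diverg η x := by
    intro x
    rw [integral_mul_const]
    simp [mollify, convolution_def]
  simp_rw [e1]
  rw [integral_integral_swap hprod]
  have e2 : ∀ t, ∫ x, ρ.normed volume t * u (x - t) * diverg η x ≤
      ρ.normed volume t * (anisoTV φ u).toReal := by
    intro t
    simp_rw [mul_assoc]
    rw [integral_const_mul]
    refine mul_le_mul_of_nonneg_left ?_ (ρ.nonneg_normed _)
    have ht : IsTestField φ fun x => η (x + t) :=
      ⟨hη.1.comp (by fun_prop), hη.2.comp_homeomorph (Homeomorph.addRight t), fun x => hη.3 _⟩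
    refine le_trans (le_of_eq ?_) (ht.integral_le hTV)
    rw [← integral_add_right_eq_self _ t]
    refine integral_congr_ae (Eventually.of_forall fun x => ?_)
    simp [diverg, fderiv_comp_add_right]
  calc _ ≤ ∫ t, ρ.normed volume t * (anisoTV φ u).toReal :=
        integral_mono hprod.integral_prod_right (ρ.integrable_normed.mul_const _) e2
    _ = (anisoTV φ u).toReal := by rw [integral_mul_const, ρ.integral_normed, one_mul]

/-- Mollifications of a nonnegative integrable function converge in `L¹`. -/
theorem exists_bump_tendsto_integral_abs_mollify_sub (hu : Integrable u) (hu0 : 0 ≤ᵐ[volume] u) :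
    ∃ ρ : ℕ → ContDiffBump (0 : Fin n → ℝ),
      Tendsto (fun k => ∫ x, |mollify (ρ k) u x - u x|) atTop (nhds 0) := by
  let ρ : ℕ → ContDiffBump (0 : Fin n → ℝ) := fun k =>
    ⟨1 / (k + 1), 2 * (1 / (k + 1)), by positivity, by
      have : (0 : ℝ) < 1 / (k + 1) := by positivity
      linarith⟩
  refine ⟨ρ, ?_⟩
  have hae := ContDiffBump.ae_convolution_tendsto_right_of_locallyIntegrable
    (μ := (volume : Measure (Fin n → ℝ))) (φ := ρ) (l := atTop) (K := 2) (g := u) ?_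
    (Eventually.of_forall fun k => le_rfl) hu.locallyIntegrable
  · have h1 : ∀ k, ∫ x, |mollify (ρ k) u x - u x| = 2 * ∫ x, max (u x - mollify (ρ k) u x) 0 := by
      intro k
      have hi := (integrable_mollify (ρ k) hu)
      have hm : Integrable fun x => max (u x - mollify (ρ k) u x) 0 := (hu.sub hi).pos_part
      have : ∀ x, |mollify (ρ k) u x - u x| = (mollify (ρ k) u x - u x) +
          2 * max (u x - mollify (ρ k) u x) 0 := by
        intro x
        rcases le_total (u x) (mollify (ρ k) u x) with h | h
        · rw [abs_of_nonneg (by linarith), max_eq_right (by linarith)]; ring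
        · rw [abs_of_nonpos (by linarith), max_eq_left (by linarith)]; ring
      simp_rw [this]
      have hsub : Integrable fun x => mollify (ρ k) u x - u x := hi.sub hu
      rw [integral_add hsub (hm.const_mul 2), integral_sub hi hu, integral_mollify _ hu,
        integral_const_mul]
      ring
    simp_rw [h1]
    suffices h : Tendsto (fun k => ∫ x, max (u x - mollify (ρ k) u x) 0) atTop
        (nhds (∫ _ : Fin n → ℝ, (0 : ℝ))) by simpa using h.const_mul 2
    refine tendsto_integral_of_dominated_convergence u (fun k => ?_) hu (fun k => ?_) ?_
    · exact (hu.sub (integrable_mollify (ρ k) hu)).pos_part.aestronglyMeasurable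
    · filter_upwards [hu0] with x hx
      have h0 := mollify_nonneg (ρ k) hu0 x
      have hx : 0 ≤ u x := hx
      rw [Real.norm_eq_abs, abs_of_nonneg (le_max_right _ _)]
      exact max_le (by linarith) hx
    · filter_upwards [hae] with x hx
      have : Tendsto (fun k => max (u x - mollify (ρ k) u x) 0) atTop
          (nhds (max (u x - u x) 0)) := (tendsto_const_nhds.sub hx).max tendsto_const_nhds
      simpa using this
  · have := (tendsto_one_div_add_atTop_nhds_zero_nat (𝕜 := ℝ)).const_mul 2
    simpa [ρ] using this

end Mollification

section Truncation

variable {n : ℕ} {φ : (Fin n → ℝ) → ℝ}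

/-- At each point, one of the derivatives of the two truncations of `f` at level `c` vanishes,
and the other one vanishes or agrees with the derivative of `f`. -/
theorem fderiv_truncation {E : Type*} [NormedAddCommGroup E] [NormedSpace ℝ E] {f : E → ℝ}
    (hf : Continuous f) (c : ℝ) (x : E) :
    (fderiv ℝ (fun y => min (f y) c) x = fderiv ℝ f x ∧
      fderiv ℝ (fun y => max (f y - c) 0) x = 0) ∨
    (fderiv ℝ (fun y => min (f y) c) x = 0 ∧
      fderiv ℝ (fun y => max (f y - c) 0) x = fderiv ℝ f x) ∨
    (fderiv ℝ (fun y => min (f y) c) x = 0 ∧ fderiv ℝ (fun y => max (f y - c) 0) x = 0) := by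
  rcases lt_trichotomy (f x) c with h | h | h
  · have hev : ∀ᶠ y in nhds x, f y < c := hf.continuousAt.eventually_lt continuousAt_const h
    left
    constructor
    · exact EventuallyEq.fderiv_eq (hev.mono fun y hy => min_eq_left hy.le)
    · have : (fun y => max (f y - c) 0) =ᶠ[nhds x] fun _ => 0 :=
        hev.mono fun y hy => max_eq_right (by linarith)
      rw [this.fderiv_eq, fderiv_fun_const]; rfl
  · right; right
    constructor
    · exact IsLocalMax.fderiv_eq_zero (Eventually.of_forall fun y => by simp [h])
    · exact IsLocalMin.fderiv_eq_zero (Eventually.of_forall fun y => by simp [h])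
  · have hev : ∀ᶠ y in nhds x, c < f y := continuousAt_const.eventually_lt hf.continuousAt h
    right; left
    constructor
    · have : (fun y => min (f y) c) =ᶠ[nhds x] fun _ => c :=
        hev.mono fun y hy => min_eq_right hy.le
      rw [this.fderiv_eq, fderiv_fun_const]; rfl
    · have : (fun y => max (f y - c) 0) =ᶠ[nhds x] fun y => f y - c :=
        hev.mono fun y hy => max_eq_left (by linarith)
      rw [this.fderiv_eq, fderiv_sub_const]

theorem integral_dualNorm_fderiv_le (hφ : IsNorm φ) {C : NNReal} {f : (Fin n → ℝ) → ℝ}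
    (hf : LipschitzWith C f) (hf' : Continuous (fderiv ℝ f)) (hTV : anisoTV φ f ≠ ∞) :
    Integrable (fun x => dualNorm φ (fderiv ℝ f x)) ∧
      ∫ x, dualNorm φ (fderiv ℝ f x) ≤ (anisoTV φ f).toReal := by
  have hle := lintegral_dualNorm_fderiv_le hφ hf hf'
  have h0 : ∀ x, 0 ≤ dualNorm φ (fderiv ℝ f x) := fun x => hφ.dualNorm_nonneg _
  have hm : AEStronglyMeasurable (fun x => dualNorm φ (fderiv ℝ f x)) volume :=
    (hφ.continuous_dualNorm.comp hf').aestronglyMeasurable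
  refine ⟨⟨hm, ?_⟩, ?_⟩
  · rw [hasFiniteIntegral_iff_ofReal (Eventually.of_forall h0)]
    exact hle.trans_lt hTV.lt_top
  · rw [integral_eq_lintegral_of_nonneg_ae (Eventually.of_forall h0) hm]
    exact ENNReal.toReal_mono hTV hle

variable {u : (Fin n → ℝ) → ℝ} {c : ℝ}

theorem integrable_min_const (hu : Integrable u) (hc : 0 ≤ c) :
    Integrable fun x => min (u x) c := by
  refine hu.norm.mono' (hu.1.inf aestronglyMeasurable_const) (Eventually.of_forall fun x => ?_)
  rw [Real.norm_eq_abs, Real.norm_eq_abs]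
  rcases le_total (u x) c with h | h
  · rw [min_eq_left h]
  · rw [min_eq_right h, abs_of_nonneg hc]
    exact h.trans (le_abs_self _)

theorem integrable_max_sub_const (hu : Integrable u) (hc : 0 ≤ c) :
    Integrable fun x => max (u x - c) 0 := by
  refine hu.norm.mono' ((hu.1.sub aestronglyMeasurable_const).sup aestronglyMeasurable_const)
    (Eventually.of_forall fun x => ?_)
  rw [Real.norm_eq_abs, Real.norm_eq_abs, abs_of_nonneg (le_max_right _ _)]
  exact max_le (by linarith [le_abs_self (u x)]) (abs_nonneg _)

theorem integral_truncation_mul_diverg_add_le (hφ : IsNorm φ) {C : NNReal}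
    {f : (Fin n → ℝ) → ℝ} (hf : LipschitzWith C f) (hf' : Continuous (fderiv ℝ f))
    (hTV : anisoTV φ f ≠ ∞) {η ζ : (Fin n → ℝ) → (Fin n → ℝ)} (hη : IsTestField φ η)
    (hζ : IsTestField φ ζ) (c : ℝ) :
    (∫ x, min (f x) c * diverg η x) + ∫ x, max (f x - c) 0 * diverg ζ x ≤
      (anisoTV φ f).toReal := by
  obtain ⟨hi, hle⟩ := integral_dualNorm_fderiv_le hφ hf hf' hTV
  obtain ⟨h1, e1⟩ := integral_mul_diverg_eq (hf.min_const c) hη.1 hη.2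
  have hl2 : LipschitzWith C fun x => max (f x - c) 0 :=
    LipschitzWith.max_const (LipschitzWith.of_dist_le_mul fun x y => by
      simpa using hf.dist_le_mul x y) 0
  obtain ⟨h2, e2⟩ := integral_mul_diverg_eq hl2 hζ.1 hζ.2
  rw [e1, e2, ← neg_add, ← integral_add h1 h2, ← integral_neg]
  refine (integral_mono (h1.add h2).neg hi fun x => ?_).trans hle
  have hη' := hφ.apply_le_dualNorm (fderiv ℝ f x) (x := -η x) (by rw [hφ.map_neg]; exact hη.3 x)
  have hζ' := hφ.apply_le_dualNorm (fderiv ℝ f x) (x := -ζ x) (by rw [hφ.map_neg]; exact hζ.3 x)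
  rw [map_neg] at hη' hζ'
  rcases fderiv_truncation hf.continuous c x with h | h | h
  · simpa [h.1, h.2] using hη'
  · simpa [h.1, h.2] using hζ'
  · simpa [h.1, h.2] using hφ.dualNorm_nonneg (fderiv ℝ f x)

theorem integral_mul_diverg_le_add {g h u v : (Fin n → ℝ) → ℝ} {C : ℝ}
    {η : (Fin n → ℝ) → (Fin n → ℝ)} (hη : ContDiff ℝ 1 η) (hc : HasCompactSupport η)
    (hC : ∀ x, |diverg η x| ≤ C) (hC0 : 0 ≤ C) (hg : Integrable g) (hh : Integrable h)
    (hu : Integrable u) (hv : Integrable v) (hle : ∀ x, |g x - h x| ≤ |u x - v x|) :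
    ∫ x, h x * diverg η x ≤ (∫ x, g x * diverg η x) + C * ∫ x, |u x - v x| := by
  have huv : Integrable fun x => |u x - v x| := (hu.sub hv).abs
  have hgi := integrable_mul_diverg hg hη hc
  rw [← integral_const_mul, ← integral_add hgi (huv.const_mul C)]
  refine integral_mono (integrable_mul_diverg hh hη hc) (hgi.add (huv.const_mul C)) fun x => ?_
  have h1 : |(h x - g x) * diverg η x| ≤ C * |u x - v x| := by
    rw [abs_mul, mul_comm, abs_sub_comm]
    exact mul_le_mul (hC x) (hle x) (abs_nonneg _) hC0
  have h2 := (le_abs_self _).trans h1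
  change h x * diverg η x ≤ g x * diverg η x + C * |u x - v x|
  linarith

/-- Truncation splits the total variation. -/
theorem anisoTV_truncation_add_le (hφ : IsNorm φ) (hu : Integrable u) (hu0 : 0 ≤ᵐ[volume] u)
    (hTV : anisoTV φ u ≠ ∞) (hc : 0 ≤ c) :
    anisoTV φ (fun x => min (u x) c) + anisoTV φ (fun x => max (u x - c) 0) ≤ anisoTV φ u := by
  have key : ∀ η ζ, IsTestField φ η → IsTestField φ ζ →
      (∫ x, min (u x) c * diverg η x) + ∫ x, max (u x - c) 0 * diverg ζ x ≤
        (anisoTV φ u).toReal := by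
    intro η ζ hη hζ
    obtain ⟨ρ, hρ⟩ := exists_bump_tendsto_integral_abs_mollify_sub hu hu0
    obtain ⟨C, hC0, hC⟩ := exists_abs_diverg_le hη.1 hη.2
    obtain ⟨D, hD0, hD⟩ := exists_abs_diverg_le hζ.1 hζ.2
    refine ge_of_tendsto (f := fun k => (anisoTV φ u).toReal +
      (C + D) * ∫ x, |mollify (ρ k) u x - u x|) (x := atTop) ?_ (Eventually.of_forall fun k => ?_)
    · simpa using (hρ.const_mul (C + D)).const_add (anisoTV φ u).toReal
    · have hi := integrable_mollify (ρ k) hu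
      have hle : anisoTV φ (mollify (ρ k) u) ≤ anisoTV φ u := anisoTV_mollify_le _ hu
      obtain ⟨K, hK⟩ := exists_lipschitzWith_mollify (ρ k) hu
      have h0 := integral_truncation_mul_diverg_add_le hφ hK (mollify_taylor (ρ k) hu).1
        (ne_top_of_le_ne_top hTV hle) hη hζ c
      have h1 := integral_mul_diverg_le_add hη.1 hη.2 hC hC0.le (integrable_min_const hi hc)
        (integrable_min_const hu hc) hi hu fun x => by
          simpa using abs_min_sub_min_le_max (mollify (ρ k) u x) c (u x) c
      have h2 := integral_mul_diverg_le_add hζ.1 hζ.2 hD hD0.le (integrable_max_sub_const hi hc)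
        (integrable_max_sub_const hu hc) hi hu fun x => by
          simpa using abs_max_sub_max_le_max (mollify (ρ k) u x - c) 0 (u x - c) 0
      have h3 := ENNReal.toReal_mono hTV hle
      linarith
  have hzero : IsTestField φ (0 : (Fin n → ℝ) → (Fin n → ℝ)) :=
    ⟨contDiff_const, HasCompactSupport.zero, fun x => by simp [hφ.map_zero]⟩
  have hdiv : ∀ x, diverg (0 : (Fin n → ℝ) → (Fin n → ℝ)) x = 0 := fun x => by simp [diverg]
  set A := anisoTV φ fun x => min (u x) c with hA
  have h1 : ∀ ζ, IsTestField φ ζ →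
      A ≤ ENNReal.ofReal ((anisoTV φ u).toReal - ∫ x, max (u x - c) 0 * diverg ζ x) :=
    fun ζ hζ => anisoTV_le fun η hη => by linarith [key η ζ hη hζ]
  have hAtop : A ≠ ∞ := ne_top_of_le_ne_top ofReal_ne_top (h1 0 hzero)
  have h2 : ∀ ζ, IsTestField φ ζ →
      A.toReal ≤ (anisoTV φ u).toReal - ∫ x, max (u x - c) 0 * diverg ζ x := fun ζ hζ => by
    refine ENNReal.toReal_le_of_le_ofReal ?_ (h1 ζ hζ)
    have := key 0 ζ hzero hζ
    simp only [hdiv, mul_zero, integral_zero, zero_add] at this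
    linarith
  have h3 : anisoTV φ (fun x => max (u x - c) 0) ≤
      ENNReal.ofReal ((anisoTV φ u).toReal - A.toReal) :=
    anisoTV_le fun ζ hζ => by linarith [h2 ζ hζ]
  have h4 : A.toReal ≤ (anisoTV φ u).toReal := by
    simpa [hdiv] using h2 0 hzero
  calc A + _ ≤ ENNReal.ofReal A.toReal + ENNReal.ofReal ((anisoTV φ u).toReal - A.toReal) := by
        rw [ENNReal.ofReal_toReal hAtop]; gcongr
    _ = anisoTV φ u := by
        rw [← ENNReal.ofReal_add toReal_nonneg (by linarith), add_sub_cancel,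
          ENNReal.ofReal_toReal hTV]

end Truncation

section Isoperimetric

variable {n : ℕ} {φ : (Fin n → ℝ) → ℝ}

theorem IsNorm.exists_dualNorm_fderiv_le (hφ : IsNorm φ) {C : NNReal} {f : (Fin n → ℝ) → ℝ}
    (hf : LipschitzWith C f) : ∃ M : ℝ, 0 ≤ M ∧ ∀ x, dualNorm φ (fderiv ℝ f x) ≤ M := by
  obtain ⟨D, hD0, hD⟩ := hφ.exists_norm_le_mul
  refine ⟨C * D, by positivity, fun x => ?_⟩
  obtain ⟨y, hy, hL⟩ := hφ.exists_apply_eq_dualNorm (fderiv ℝ f x)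
  rw [← hL]
  calc fderiv ℝ f x y ≤ ‖fderiv ℝ f x y‖ := Real.le_norm_self _
    _ ≤ ‖fderiv ℝ f x‖ * ‖y‖ := ContinuousLinearMap.le_opNorm _ _
    _ ≤ C * D := by
      gcongr
      · exact norm_fderiv_le_of_lipschitz ℝ hf
      · exact (hD y).trans (mul_le_of_le_one_right hD0.le hy)

/-- If superlevel sets of `f` above level `τ`, enlarged by `ε` times the Wulff shape, are contained
in superlevel sets of `h`, then the Brunn–Minkowski inequality compares the integrals. -/
theorem ofReal_mul_lintegral_le_of_dilation (hφ : IsNorm φ) {f h : (Fin n → ℝ) → ℝ}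
    (hf : Continuous f) (hh : Continuous h) {ρ ε τ : ℝ} (hρ : 0 < ρ) (hε : 0 < ε)
    (hvol : volume {x | τ < f x} ≤ ENNReal.ofReal (ρ ^ n) * volume (wulffBall φ 0 1))
    (hle : ∀ x, ∀ y ∈ wulffBall φ 0 1, f x ≤ h (x + ε • y)) :
    ENNReal.ofReal (1 + n * ε / ρ) * ∫⁻ x, ENNReal.ofReal (max (f x - τ) 0) ≤
      ∫⁻ x, ENNReal.ofReal (max (h x - τ) 0) := by
  have hcake : ∀ g : (Fin n → ℝ) → ℝ, Continuous g →
      ∫⁻ x, ENNReal.ofReal (max (g x - τ) 0) =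
        ∫⁻ t in Ioi (0 : ℝ), volume {x | t < max (g x - τ) 0} := fun g hg =>
    lintegral_eq_lintegral_meas_lt _ (Eventually.of_forall fun x => le_max_right _ _)
      (by fun_prop)
  rw [hcake f hf, hcake h hh, ← lintegral_const_mul' _ _ ofReal_ne_top]
  refine setLIntegral_mono' measurableSet_Ioi fun t ht => ?_
  have ht : 0 < t := ht
  have hset : ∀ g : (Fin n → ℝ) → ℝ, {x | t < max (g x - τ) 0} = {x | t + τ < g x} := by
    intro g
    ext x
    simp only [mem_ofPred_eq, lt_max_iff, lt_sub_iff_add_lt]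
    exact ⟨fun h => h.resolve_right (not_lt.2 ht.le), Or.inl⟩
  rw [hset, hset]
  refine brunn_minkowski_dilation (isOpen_lt continuous_const hf).measurableSet
    (hφ.isOpen_wulffBall 0 1).measurableSet (isOpen_lt continuous_const hh).measurableSet
    (hφ.volume_wulffBall_ne_zero 0 one_pos) hφ.volume_wulffBall_ne_top hρ hε
    ((measure_mono fun x hx => ?_).trans hvol) fun x hx y hy => ?_
  · have hx : t + τ < f x := hx
    show τ < f x
    linarith
  · exact lt_of_lt_of_le hx (hle x y hy)

/-- The linear isoperimetric inequality for the part of a smooth function above a level. -/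
theorem mul_integral_max_sub_le (hφ : IsNorm φ) {C : NNReal} {f : (Fin n → ℝ) → ℝ}
    (hf : LipschitzWith C f) (hf' : Continuous (fderiv ℝ f)) (hfi : Integrable f)
    (hTV : anisoTV φ f ≠ ∞) {K : ℝ} (hK0 : 0 ≤ K)
    (hK : ∀ x y, |f (x + y) - f x - fderiv ℝ f x y| ≤ K * ‖y‖ ^ 2) {ρ τ : ℝ} (hρ : 0 < ρ)
    (hτ : 0 < τ)
    (hvol : volume {x | τ < f x} ≤ ENNReal.ofReal (ρ ^ n) * volume (wulffBall φ 0 1)) :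
    n / ρ * ∫ x, max (f x - τ) 0 ≤ (anisoTV φ f).toReal := by
  obtain ⟨M, hM0, hM⟩ := hφ.exists_dualNorm_fderiv_le hf
  obtain ⟨D, hD0, hD⟩ := hφ.exists_norm_le_mul
  obtain ⟨hgi, hgle⟩ := integral_dualNorm_fderiv_le hφ hf hf' hTV
  set g := fun x => dualNorm φ (fderiv ℝ f x) with hg
  have hgc : Continuous g := hφ.continuous_dualNorm.comp hf'
  have hg0 : ∀ x, 0 ≤ g x := fun x => hφ.dualNorm_nonneg _
  set S : Set (Fin n → ℝ) := {x | τ / 2 < f x} with hS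
  have hSm : MeasurableSet S := (isOpen_lt continuous_const hf.continuous).measurableSet
  have hSfin : volume S ≠ ∞ := (hfi.measure_gt_lt_top (half_pos hτ)).ne
  have hpi : Integrable fun x => max (f x - τ) 0 := integrable_max_sub_const hfi hτ.le
  have main : ∀ κ : ℝ, 0 < κ →
      n / ρ * ∫ x, max (f x - τ) 0 ≤ (∫ x, g x) + κ * volume.real S := by
    intro κ hκ
    obtain ⟨ε, hε, hε1, hε2⟩ : ∃ ε : ℝ, 0 < ε ∧ K * ε * D ^ 2 ≤ κ ∧ ε * (M + κ) ≤ τ / 2 := by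
      refine ⟨min (κ / (K * D ^ 2 + 1)) (τ / 2 / (M + κ)), by positivity, ?_, ?_⟩
      · have h1 : min (κ / (K * D ^ 2 + 1)) (τ / 2 / (M + κ)) ≤ κ / (K * D ^ 2 + 1) :=
          min_le_left _ _
        calc _ ≤ K * (κ / (K * D ^ 2 + 1)) * D ^ 2 := by gcongr
          _ = κ * (K * D ^ 2 / (K * D ^ 2 + 1)) := by ring
          _ ≤ κ * 1 := by
            gcongr
            rw [div_le_one (by positivity)]
            linarith
          _ = κ := mul_one κ
      · rw [← le_div_iff₀ (by positivity)]
        exact min_le_right _ _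
    have hind : Integrable (S.indicator fun _ => ε * κ) :=
      (integrable_indicator_iff hSm).2 (integrableOn_const hSfin)
    have hdil := ofReal_mul_lintegral_le_of_dilation hφ (h := fun x => f x + ε * g x + ε * κ)
      hf.continuous (by have := hf.continuous; fun_prop) hρ hε hvol fun x y hy => by
        have hy : φ (y - 0) < 1 := hy
        rw [sub_zero] at hy
        have h1 := hK (x + ε • y) (-(ε • y))
        rw [add_neg_cancel_right, map_neg, map_smul, smul_eq_mul, norm_neg, norm_smul,
          Real.norm_eq_abs, abs_of_pos hε] at h1
        have h2 := hφ.apply_le_dualNorm (fderiv ℝ f (x + ε • y)) (x := -y)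
          (by rw [hφ.map_neg]; exact hy.le)
        rw [map_neg] at h2
        have h3 : ‖y‖ ≤ D := (hD y).trans (mul_le_of_le_one_right hD0.le hy.le)
        have h4 : K * (ε * ‖y‖) ^ 2 ≤ ε * κ := by
          calc K * (ε * ‖y‖) ^ 2 ≤ K * (ε * D) ^ 2 := by gcongr
            _ = ε * (K * ε * D ^ 2) := by ring
            _ ≤ ε * κ := by gcongr
        have h5 := mul_le_mul_of_nonneg_left h2 hε.le
        have h6 := (le_abs_self _).trans h1
        simp only [hg]
        linarith
    have hpt : ∀ x, max (f x + ε * g x + ε * κ - τ) 0 ≤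
        max (f x - τ) 0 + ε * g x + S.indicator (fun _ => ε * κ) x := by
      intro x
      have hεg := mul_nonneg hε.le (hg0 x)
      by_cases hx : x ∈ S
      · rw [indicator_of_mem hx]
        refine max_le ?_ ?_
        · linarith [le_max_left (f x - τ) 0]
        · have := le_max_right (f x - τ) 0
          positivity
      · rw [indicator_of_notMem hx]
        have hx : f x ≤ τ / 2 := not_lt.1 hx
        have h1 : ε * g x + ε * κ ≤ τ / 2 := by
          rw [← mul_add]
          refine le_trans ?_ hε2
          have := hM x
          gcongr
        rw [max_eq_right (by linarith)]
        have := le_max_right (f x - τ) 0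
        positivity
    have hRi : Integrable fun x =>
        max (f x - τ) 0 + ε * g x + S.indicator (fun _ => ε * κ) x :=
      (hpi.add (hgi.const_mul ε)).add hind
    have hle := hdil.trans (lintegral_mono fun x => ENNReal.ofReal_le_ofReal (hpt x))
    rw [← ofReal_integral_eq_lintegral_ofReal hpi (Eventually.of_forall fun x => le_max_right _ _),
      ← ofReal_integral_eq_lintegral_ofReal hRi
        (Eventually.of_forall fun x => (le_max_right _ _).trans (hpt x)),
      ← ENNReal.ofReal_mul (by positivity), ENNReal.ofReal_le_ofReal_iff
        (integral_nonneg fun x => (le_max_right _ _).trans (hpt x))] at hle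
    have hsum : Integrable fun x => max (f x - τ) 0 + ε * g x := hpi.add (hgi.const_mul ε)
    rw [integral_add hsum hind, integral_add hpi (hgi.const_mul ε), integral_const_mul,
      integral_indicator hSm, setIntegral_const, smul_eq_mul] at hle
    have : ε * (n / ρ * ∫ x, max (f x - τ) 0) ≤ ε * ((∫ x, g x) + κ * volume.real S) := by
      have e : (n : ℝ) * ε / ρ = ε * (n / ρ) := by ring
      rw [e] at hle
      linarith
    exact le_of_mul_le_mul_left this hε
  refine le_trans ?_ hgle
  refine le_of_forall_pos_le_add fun e he => ?_
  have hS0 : 0 ≤ volume.real S := measureReal_nonneg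
  refine (main (e / (volume.real S + 1)) (by positivity)).trans ?_
  gcongr
  rw [div_mul_eq_mul_div, div_le_iff₀ (by positivity)]
  nlinarith

/-- A linear isoperimetric inequality for functions whose support has small volume. -/
theorem mul_integral_le_anisoTV (hφ : IsNorm φ) {w : (Fin n → ℝ) → ℝ} (hw : Integrable w)
    (hw0 : 0 ≤ᵐ[volume] w) (hTV : anisoTV φ w ≠ ∞) {ρ : ℝ} (hρ : 0 < ρ)
    (hvol : volume {x | 0 < w x} < ENNReal.ofReal (ρ ^ n) * volume (wulffBall φ 0 1)) :
    n / ρ * ∫ x, w x ≤ (anisoTV φ w).toReal := by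
  obtain ⟨r, hr⟩ := exists_bump_tendsto_integral_abs_mollify_sub hw hw0
  have hdi : ∀ k, Integrable fun x => |mollify (r k) w x - w x| := fun k =>
    ((integrable_mollify (r k) hw).sub hw).abs
  have step : ∀ τ : ℝ, 0 < τ → n / ρ * ∫ x, max (w x - τ) 0 ≤ (anisoTV φ w).toReal := by
    intro τ hτ
    have hev : ∀ᶠ k in atTop, volume {x | τ < mollify (r k) w x} ≤
        ENNReal.ofReal (ρ ^ n) * volume (wulffBall φ 0 1) := by
      have ht : Tendsto (fun k => ENNReal.ofReal ((∫ x, |mollify (r k) w x - w x|) / τ) +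
          volume {x | 0 < w x}) atTop (nhds (volume {x | 0 < w x})) := by
        simpa using (ENNReal.tendsto_ofReal (hr.div_const τ)).add_const (volume {x | 0 < w x})
      filter_upwards [ht.eventually_lt_const hvol] with k hk
      refine le_trans ?_ hk.le
      have hmarkov : volume {x | τ ≤ |mollify (r k) w x - w x|} ≤
          ENNReal.ofReal ((∫ x, |mollify (r k) w x - w x|) / τ) := by
        have hfin : volume {x | τ ≤ |mollify (r k) w x - w x|} ≠ ∞ :=
          ((hdi k).measure_ge_lt_top hτ).ne
        rw [← ENNReal.ofReal_toReal hfin]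
        refine ENNReal.ofReal_le_ofReal ?_
        rw [le_div_iff₀ hτ, mul_comm]
        exact mul_meas_ge_le_integral_of_nonneg (Eventually.of_forall fun x => abs_nonneg _)
          (hdi k) τ
      refine le_trans (measure_mono fun x hx => ?_)
        ((measure_union_le _ _).trans (add_le_add_left hmarkov _))
      have hx : τ < mollify (r k) w x := hx
      by_cases h0 : 0 < w x
      · exact Or.inr h0
      · left
        show τ ≤ |mollify (r k) w x - w x|
        exact le_trans (by linarith) (le_abs_self _)
    have hlim : Tendsto (fun k => (anisoTV φ w).toReal +
        n / ρ * ∫ x, |mollify (r k) w x - w x|) atTop (nhds (anisoTV φ w).toReal) := by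
      simpa using (hr.const_mul (n / ρ)).const_add (anisoTV φ w).toReal
    refine ge_of_tendsto hlim ?_
    filter_upwards [hev] with k hk
    have hle : anisoTV φ (mollify (r k) w) ≤ anisoTV φ w := anisoTV_mollify_le _ hw
    obtain ⟨C, hC⟩ := exists_lipschitzWith_mollify (r k) hw
    obtain ⟨hcont, K, hK0, hK⟩ := mollify_taylor (r k) hw
    have hi := integrable_mollify (r k) hw
    have h1 := mul_integral_max_sub_le hφ hC hcont hi (ne_top_of_le_ne_top hTV hle) hK0 hK hρ hτ hk
    have hpi := integrable_max_sub_const hi hτ.le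
    have h2 : ∫ x, max (w x - τ) 0 ≤
        (∫ x, max (mollify (r k) w x - τ) 0) + ∫ x, |mollify (r k) w x - w x| := by
      rw [← integral_add hpi (hdi k)]
      refine integral_mono (integrable_max_sub_const hw hτ.le) (hpi.add (hdi k)) fun x => ?_
      have := abs_max_sub_max_le_max (w x - τ) 0 (mollify (r k) w x - τ) 0
      have h' := (le_abs_self _).trans this
      simp only [sub_sub_sub_cancel_right, sub_self, abs_zero, abs_nonneg, sup_of_le_left] at h'
      rw [abs_sub_comm] at h'
      change max (w x - τ) 0 ≤ max (mollify (r k) w x - τ) 0 + |mollify (r k) w x - w x|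
      linarith
    have h3 : (n : ℝ) / ρ * ∫ x, max (w x - τ) 0 ≤ n / ρ *
        ((∫ x, max (mollify (r k) w x - τ) 0) + ∫ x, |mollify (r k) w x - w x|) := by gcongr
    have h4 := ENNReal.toReal_mono hTV hle
    linarith
  have hlim : Tendsto (fun k : ℕ => ∫ x, max (w x - 1 / ((k : ℝ) + 1)) 0) atTop
      (nhds (∫ x, w x)) := by
    refine tendsto_integral_of_dominated_convergence w (fun k => ?_) hw (fun k => ?_) ?_
    · exact (integrable_max_sub_const hw (by positivity)).1
    · filter_upwards [hw0] with x hx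
      have hx : 0 ≤ w x := hx
      rw [Real.norm_eq_abs, abs_of_nonneg (le_max_right _ _)]
      have : (0 : ℝ) ≤ 1 / ((k : ℝ) + 1) := by positivity
      exact max_le (by linarith) hx
    · filter_upwards [hw0] with x hx
      have hx : 0 ≤ w x := hx
      have := (tendsto_const_nhds (x := w x)).sub
        (tendsto_one_div_add_atTop_nhds_zero_nat (𝕜 := ℝ)) |>.max (tendsto_const_nhds (x := (0:ℝ)))
      simpa [hx] using this
  exact le_of_tendsto (hlim.const_mul _) (Eventually.of_forall fun k => step _ (by positivity))

end Isoperimetric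

section WulffPerimeter

variable {n : ℕ} {φ : (Fin n → ℝ) → ℝ}

theorem IsNorm.volume_wulffBall_lt_top (hφ : IsNorm φ) (x : Fin n → ℝ) {r : ℝ} (hr : 0 < r) :
    volume (wulffBall φ x r) < ∞ := by
  rw [hφ.volume_wulffBall x hr]
  exact ENNReal.mul_lt_top ofReal_lt_top hφ.volume_wulffBall_ne_top.lt_top

theorem IsNorm.volume_real_wulffBall (hφ : IsNorm φ) (x : Fin n → ℝ) {r : ℝ} (hr : 0 < r) :
    volume.real (wulffBall φ x r) = r ^ n * volume.real (wulffBall φ 0 1) := by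
  rw [measureReal_def, hφ.volume_wulffBall x hr, ENNReal.toReal_mul,
    ENNReal.toReal_ofReal (by positivity), measureReal_def]

theorem abs_fderiv_le_of_abs_sub_le (hφ : IsNorm φ) {g : (Fin n → ℝ) → ℝ} {c : ℝ} (hc : 0 ≤ c)
    (hg : ∀ y z, |g y - g z| ≤ c * φ (y - z)) (y : Fin n → ℝ) {ξ : Fin n → ℝ} (hξ : φ ξ ≤ 1) :
    |fderiv ℝ g y ξ| ≤ c := by
  by_cases hd : DifferentiableAt ℝ g y
  · rw [← hd.lineDeriv_eq_fderiv, lineDeriv, ← Real.norm_eq_abs]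
    have hl : LipschitzWith (NNReal.mk c hc) fun s : ℝ => g (y + s • ξ) := by
      refine LipschitzWith.of_dist_le_mul fun s s' => ?_
      rw [Real.dist_eq, Real.dist_eq, NNReal.coe_mk]
      refine (hg _ _).trans ?_
      rw [add_sub_add_left_eq_sub, ← sub_smul, hφ.smul_eq]
      gcongr
      exact mul_le_of_le_one_right (abs_nonneg _) hξ
    exact norm_deriv_le_of_lipschitz hl
  · rw [fderiv_zero_of_not_differentiableAt hd]
    simpa using hc

theorem integral_ramp_mul_diverg_le (hφ : IsNorm φ) (x : Fin n → ℝ) {r t : ℝ} (ht : 0 < t)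
    (htr : t < r) {η : (Fin n → ℝ) → (Fin n → ℝ)} (hη : IsTestField φ η) :
    ∫ y, min 1 (max ((r - φ (y - x)) / t) 0) * diverg η y ≤
      n / r * volume.real (wulffBall φ x r) := by
  have hr : 0 < r := ht.trans htr
  set g : (Fin n → ℝ) → ℝ := fun y => min 1 (max ((r - φ (y - x)) / t) 0) with hg
  have hgl : ∀ y z, |g y - g z| ≤ t⁻¹ * φ (y - z) := by
    intro y z
    have h1 := abs_min_sub_min_le_max 1 (max ((r - φ (y - x)) / t) 0)
      1 (max ((r - φ (z - x)) / t) 0)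
    have h2 := abs_max_sub_max_le_max ((r - φ (y - x)) / t) 0 ((r - φ (z - x)) / t) 0
    simp only [sub_self, abs_zero, abs_nonneg, sup_of_le_left, sup_of_le_right] at h1 h2
    refine h1.trans (h2.trans ?_)
    have h3 := hφ.abs_sub_le (z - x) (y - x)
    rw [sub_sub_sub_cancel_right, ← neg_sub y z, hφ.map_neg] at h3
    rw [← sub_div, show r - φ (y - x) - (r - φ (z - x)) = φ (z - x) - φ (y - x) by ring, abs_div,
      abs_of_pos ht, div_eq_inv_mul]
    gcongr
  obtain ⟨D, hD0, hD⟩ := hφ.exists_le_mul_norm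
  have hL : LipschitzWith (NNReal.mk (t⁻¹ * D) (by positivity)) g := by
    refine LipschitzWith.of_dist_le_mul fun y z => ?_
    rw [Real.dist_eq, dist_eq_norm, NNReal.coe_mk, mul_assoc]
    refine (hgl y z).trans ?_
    gcongr
    exact hD _
  obtain ⟨hi, he⟩ := integral_mul_diverg_eq hL hη.1 hη.2
  rw [he, ← integral_neg]
  set S := wulffBall φ x r \ wulffBall φ x (r - t) with hS
  have hsub : wulffBall φ x (r - t) ⊆ wulffBall φ x r := fun y hy =>
    lt_trans hy (by linarith : r - t < r)
  have hSm : MeasurableSet S :=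
    (hφ.isOpen_wulffBall x r).measurableSet.diff (hφ.isOpen_wulffBall x _).measurableSet
  have hfin := hφ.volume_wulffBall_lt_top x hr
  have hSfin : volume S ≠ ∞ := ((measure_mono sdiff_subset).trans_lt hfin).ne
  have hpt : ∀ y, -fderiv ℝ g y (η y) ≤ S.indicator (fun _ => t⁻¹) y := by
    intro y
    by_cases hy : y ∈ S
    · rw [indicator_of_mem hy]
      exact (neg_le_abs _).trans
        (abs_fderiv_le_of_abs_sub_le hφ (by positivity) hgl y (hη.3 y))
    · rw [indicator_of_notMem hy]
      have hzero : fderiv ℝ g y = 0 := by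
        by_cases hyr : φ (y - x) < r
        · have hyt : φ (y - x) < r - t := not_not.1 fun h => hy ⟨hyr, h⟩
          have hgy : g y = 1 := by
            refine min_eq_left (le_trans ?_ (le_max_left _ _))
            rw [le_div_iff₀ ht]
            linarith
          refine IsLocalMax.fderiv_eq_zero (Eventually.of_forall fun z => ?_)
          rw [hgy]
          exact min_le_left _ _
        · have hgy : g y = 0 := by
            simp only [hg]
            rw [max_eq_right (div_nonpos_of_nonpos_of_nonneg (by linarith) ht.le),
              min_eq_right zero_le_one]
          refine IsLocalMin.fderiv_eq_zero (Eventually.of_forall fun z => ?_)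
          rw [hgy]
          exact le_min zero_le_one (le_max_right _ _)
      simp [hzero]
  have hind : Integrable (S.indicator fun _ => t⁻¹) :=
    (integrable_indicator_iff hSm).2 (integrableOn_const hSfin)
  refine (integral_mono hi.neg hind hpt).trans ?_
  rw [integral_indicator hSm, setIntegral_const, smul_eq_mul, hS,
    measureReal_sdiff hsub (hφ.isOpen_wulffBall x _).measurableSet hfin.ne,
    hφ.volume_real_wulffBall x hr, hφ.volume_real_wulffBall x (sub_pos.2 htr)]
  have hb : r ^ n - (r - t) ^ n ≤ t * (n / r * r ^ n) := by
    have htr1 : t / r < 1 := (div_lt_one hr).2 htr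
    have h1 := one_add_mul_le_pow (a := -(t / r)) (by linarith) n
    have h2 : (r - t) ^ n = r ^ n * (1 + -(t / r)) ^ n := by
      rw [← mul_pow]
      congr 1
      field_simp
      ring
    rw [h2]
    have h3 := mul_le_mul_of_nonneg_left h1 (pow_nonneg hr.le n)
    have h4 : r ^ n * (1 + n * -(t / r)) = r ^ n - t * (n / r * r ^ n) := by ring
    linarith
  have hω : 0 ≤ volume.real (wulffBall φ 0 1) := measureReal_nonneg
  calc _ = (r ^ n - (r - t) ^ n) * volume.real (wulffBall φ 0 1) * t⁻¹ := by ring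
    _ ≤ t * (n / r * r ^ n) * volume.real (wulffBall φ 0 1) * t⁻¹ := by gcongr
    _ = _ := by field_simp

/-- The anisotropic perimeter of a Wulff ball is at most `n / r` times its volume. -/
theorem anisoPerimeter_wulffBall_le (hφ : IsNorm φ) (x : Fin n → ℝ) {r : ℝ} (hr : 0 < r) :
    anisoPerimeter φ (wulffBall φ x r) ≤
      ENNReal.ofReal (n / r * volume.real (wulffBall φ x r)) := by
  refine anisoTV_le fun η hη => ?_
  set t : ℕ → ℝ := fun k => r / 2 * (1 / ((k : ℝ) + 1)) with ht
  have ht0 : ∀ k, 0 < t k := fun k => by positivity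
  have htr : ∀ k, t k < r := fun k => by
    have : 1 / ((k : ℝ) + 1) ≤ 1 := by
      rw [div_le_one (by positivity)]
      linarith [(Nat.cast_nonneg k : (0 : ℝ) ≤ k)]
    have := mul_le_mul_of_nonneg_left this (half_pos hr).le
    simp only [ht]
    linarith
  have htlim : Tendsto t atTop (nhds 0) := by
    simpa [ht] using (tendsto_one_div_add_atTop_nhds_zero_nat (𝕜 := ℝ)).const_mul (r / 2)
  have hdint : Integrable (diverg η) :=
    (continuous_diverg hη.1).integrable_of_hasCompactSupport (hasCompactSupport_diverg hη.2)
  have hlim : Tendsto (fun k => ∫ y, min 1 (max ((r - φ (y - x)) / t k) 0) * diverg η y) atTop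
      (nhds (∫ y, (wulffBall φ x r).indicator 1 y * diverg η y)) := by
    refine tendsto_integral_of_dominated_convergence (fun y => ‖diverg η y‖) (fun k => ?_)
      hdint.norm (fun k => Eventually.of_forall fun y => ?_) (Eventually.of_forall fun y => ?_)
    · have h1 := hφ.continuous
      have h2 := continuous_diverg hη.1
      exact Continuous.aestronglyMeasurable (by fun_prop)
    · rw [norm_mul]
      refine mul_le_of_le_one_left (norm_nonneg _) ?_
      rw [Real.norm_eq_abs, abs_of_nonneg (le_min zero_le_one (le_max_right _ _))]
      exact min_le_left _ _
    · refine Tendsto.mul_const _ ?_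
      by_cases hy : y ∈ wulffBall φ x r
      · rw [indicator_of_mem hy, Pi.one_apply]
        have hy' : φ (y - x) < r := hy
        refine tendsto_const_nhds.congr' ?_
        filter_upwards [htlim.eventually_lt_const (sub_pos.2 hy')] with k hk
        refine (min_eq_left (le_trans ?_ (le_max_left _ _))).symm
        rw [le_div_iff₀ (ht0 k)]
        linarith
      · rw [indicator_of_notMem hy]
        have hy' : r ≤ φ (y - x) := not_lt.1 hy
        refine tendsto_const_nhds.congr fun k => ?_
        rw [max_eq_right (div_nonpos_of_nonpos_of_nonneg (by linarith) (ht0 k).le),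
          min_eq_right zero_le_one]
  exact le_of_tendsto hlim (Eventually.of_forall fun k =>
    integral_ramp_mul_diverg_le hφ x (ht0 k) (htr k) hη)

end WulffPerimeter

section Competitor

variable {n : ℕ} {φ : (Fin n → ℝ) → ℝ}

theorem IsNorm.volume_real_wulffBall_pos (hφ : IsNorm φ) (x : Fin n → ℝ) {r : ℝ} (hr : 0 < r) :
    0 < volume.real (wulffBall φ x r) :=
  ENNReal.toReal_pos (hφ.volume_wulffBall_ne_zero x hr) (hφ.volume_wulffBall_lt_top x hr).ne

theorem IsNorm.exists_volume_real_wulffBall_eq (hφ : IsNorm φ) (hn : n ≠ 0) (x : Fin n → ℝ)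
    {a : ℝ} (ha : 0 < a) : ∃ r, 0 < r ∧ volume.real (wulffBall φ x r) = a := by
  have hω := hφ.volume_real_wulffBall_pos 0 one_pos
  have hr : 0 < (a / volume.real (wulffBall φ 0 1)) ^ ((n : ℝ)⁻¹) := by positivity
  refine ⟨_, hr, ?_⟩
  rw [hφ.volume_real_wulffBall x hr, Real.rpow_inv_natCast_pow (by positivity) hn,
    div_mul_cancel₀ _ hω.ne']

theorem IsNorm.lt_of_volume_real_wulffBall_lt (hφ : IsNorm φ) {x y : Fin n → ℝ} {r s : ℝ}
    (hr : 0 < r) (hs : 0 < s)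
    (h : volume.real (wulffBall φ x r) < volume.real (wulffBall φ y s)) : r < s := by
  rw [hφ.volume_real_wulffBall x hr, hφ.volume_real_wulffBall y hs] at h
  exact lt_of_pow_lt_pow_left₀ n hs.le (lt_of_mul_lt_mul_right h measureReal_nonneg)

theorem IsNorm.exists_wulffBall_subset (hφ : IsNorm φ) {Ω : Set (Fin n → ℝ)} (hΩ : IsOpen Ω)
    {x : Fin n → ℝ} (hx : x ∈ Ω) : ∃ r, 0 < r ∧ wulffBall φ x r ⊆ Ω := by
  obtain ⟨e, he, hball⟩ := Metric.isOpen_iff.1 hΩ x hx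
  obtain ⟨C, hC0, hC⟩ := hφ.exists_norm_le_mul
  refine ⟨e / C, by positivity, fun y hy => hball ?_⟩
  have hy : φ (y - x) < e / C := hy
  rw [mem_ball_iff_norm]
  refine (hC _).trans_lt ?_
  rwa [lt_div_iff₀ hC0, mul_comm] at hy

theorem tendsto_integral_max_sub_natCast {u : (Fin n → ℝ) → ℝ} (hu : Integrable u) :
    Tendsto (fun j : ℕ => ∫ x, max (u x - j) 0) atTop (nhds 0) := by
  suffices h : Tendsto (fun j : ℕ => ∫ x, max (u x - j) 0) atTop
      (nhds (∫ _ : Fin n → ℝ, (0 : ℝ))) by simpa using h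
  refine tendsto_integral_of_dominated_convergence (fun x => ‖u x‖)
    (fun j => (integrable_max_sub_const hu j.cast_nonneg).1) hu.norm
    (fun j => Eventually.of_forall fun x => ?_) (Eventually.of_forall fun x => ?_)
  · rw [Real.norm_eq_abs, Real.norm_eq_abs, abs_of_nonneg (le_max_right _ _)]
    have : (0 : ℝ) ≤ j := j.cast_nonneg
    exact max_le (by linarith [le_abs_self (u x)]) (abs_nonneg _)
  · obtain ⟨N, hN⟩ := exists_nat_ge (u x)
    refine tendsto_const_nhds.congr' ?_
    filter_upwards [eventually_ge_atTop N] with j hj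
    have : (N : ℝ) ≤ j := by exact_mod_cast hj
    exact (max_eq_right (by linarith)).symm

theorem volume_real_lt_integral_max_sub {Ω : Set (Fin n → ℝ)} {u : (Fin n → ℝ) → ℝ}
    (hΩfin : volume Ω ≠ ∞) (hu : Integrable u) (hΩ : ∀ᵐ x, x ∉ Ω → u x = 0)
    (hN : ∀ᵐ x, ∃ k : ℕ, u x = k) (j : ℕ) (hj : ¬ ∀ᵐ x, u x ≤ (j + 1 : ℕ)) :
    volume {x | 0 < max (u x - j) 0} ≠ ∞ ∧
      volume.real {x | 0 < max (u x - j) 0} < ∫ x, max (u x - j) 0 := by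
  have hw := integrable_max_sub_const hu j.cast_nonneg
  have hw' := integrable_max_sub_const hu (j + 1).cast_nonneg
  set A := {x | 0 < max (u x - j) 0} with hA
  have hAm : NullMeasurableSet A := nullMeasurableSet_lt aemeasurable_const hw.aemeasurable
  have hAfin : volume A ≠ ∞ := by
    refine ne_top_of_le_ne_top hΩfin (measure_mono_ae ?_)
    filter_upwards [hΩ] with x hx hxA
    by_contra hxΩ
    have hxA : 0 < max (u x - j) 0 := hxA
    have : (0 : ℝ) ≤ j := j.cast_nonneg
    rw [hx hxΩ, max_eq_right (by linarith)] at hxA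
    exact hxA.false
  refine ⟨hAfin, ?_⟩
  have hAi : Integrable (A.indicator fun _ => (1 : ℝ)) :=
    (integrableOn_const hAfin).integrable_indicator₀ hAm
  have hAint : ∫ x, A.indicator (fun _ => (1 : ℝ)) x = volume.real A := by
    rw [integral_indicator₀ hAm, setIntegral_const, smul_eq_mul, mul_one]
  have hpos : 0 < ∫ x, max (u x - (j + 1 : ℕ)) 0 := by
    refine (integral_nonneg fun x => le_max_right _ _).lt_of_ne' fun h0 => hj ?_
    rw [integral_eq_zero_iff_of_nonneg (fun x => le_max_right _ _) hw'] at h0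
    filter_upwards [h0] with x hx
    have hx : max (u x - (j + 1 : ℕ)) 0 = 0 := hx
    linarith [le_max_left (u x - (j + 1 : ℕ)) 0]
  have hle : ∫ x, max (u x - (j + 1 : ℕ)) 0 ≤ (∫ x, max (u x - j) 0) - volume.real A := by
    rw [← hAint, ← integral_sub hw hAi]
    refine integral_mono_ae hw' (hw.sub hAi) ?_
    filter_upwards [hN] with x ⟨k, hk⟩
    by_cases hx : x ∈ A
    · rw [indicator_of_mem hx]
      have hx : 0 < max (u x - j) 0 := hx
      have hkj : j < k := by
        by_contra hkj
        have : (k : ℝ) ≤ j := by exact_mod_cast not_lt.1 hkj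
        rw [hk, max_eq_right (by linarith)] at hx
        exact hx.false
      have hkj : ((j + 1 : ℕ) : ℝ) ≤ k := by exact_mod_cast hkj
      rw [hk, max_eq_left (by linarith)]
      push_cast at hkj ⊢
      linarith [le_max_left ((k : ℝ) - j) 0]
    · rw [indicator_of_notMem hx, sub_zero]
      push_cast
      gcongr
      linarith
  linarith

/-- Replacing the part of `u` above level `j` by a Wulff ball contained in `Ω` of the same mass
preserves admissibility. -/
theorem Admissible.truncation_add_wulffBall (hφ : IsNorm φ) {Ω : Set (Fin n → ℝ)} {m : ℝ}
    {u : (Fin n → ℝ) → ℝ} (hu : Admissible φ Ω m u) (j : ℕ) {x : Fin n → ℝ} {r : ℝ} (hr : 0 < r)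
    (hsub : wulffBall φ x r ⊆ Ω)
    (hvol : volume.real (wulffBall φ x r) = ∫ y, max (u y - j) 0)
    (hTV : anisoTV φ (fun y => min (u y) j + (wulffBall φ x r).indicator 1 y) ≠ ∞) :
    Admissible φ Ω m fun y => min (u y) j + (wulffBall φ x r).indicator 1 y := by
  obtain ⟨⟨hui, -⟩, hΩ, hN, hm⟩ := hu
  have hWm : MeasurableSet (wulffBall φ x r) := (hφ.isOpen_wulffBall x r).measurableSet
  have h1 := integrable_min_const hui j.cast_nonneg
  have h2 : Integrable ((wulffBall φ x r).indicator (1 : (Fin n → ℝ) → ℝ)) :=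
    (integrable_indicator_iff hWm).2 (integrableOn_const (hφ.volume_wulffBall_lt_top x hr).ne)
  have hv0 : ∀ᵐ y, y ∉ Ω → min (u y) j + (wulffBall φ x r).indicator 1 y = 0 := by
    filter_upwards [hΩ] with y hy hyΩ
    rw [hy hyΩ, indicator_of_notMem fun h => hyΩ (hsub h), min_eq_left j.cast_nonneg, add_zero]
  refine ⟨⟨h1.add h2, hTV⟩, hv0, ?_, ?_⟩
  · filter_upwards [hN] with y ⟨k, hk⟩
    by_cases hy : y ∈ wulffBall φ x r
    · exact ⟨min k j + 1, by rw [indicator_of_mem hy, hk]; simp⟩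
    · exact ⟨min k j, by rw [indicator_of_notMem hy, hk]; simp⟩
  · rw [setIntegral_eq_integral_of_ae_compl_eq_zero hv0, integral_add h1 h2,
      integral_indicator_one hWm, hvol, ← integral_add h1
        (integrable_max_sub_const hui j.cast_nonneg), ← hm,
      setIntegral_eq_integral_of_ae_compl_eq_zero hΩ]
    refine integral_congr_ae (Eventually.of_forall fun y => ?_)
    rcases le_total (u y) j with h | h
    · simp [h]
    · simp [h]

end Competitor

/-- Every minimizer of problem (1) is essentially bounded:
some level set `{u ≥ j}` has measure zero, i.e. `u ≤ j` a.e. for some `j ∈ ℕ`. -/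
theorem minimizer_essBounded {n : ℕ} (hn : 1 ≤ n)
    (φ : (Fin n → ℝ) → ℝ) (hφ : IsNorm φ)
    (Ω : Set (Fin n → ℝ)) (hΩopen : IsOpen Ω) (hΩne : Ω.Nonempty)
    (hΩfin : volume Ω ≠ ⊤) (m : ℝ) (hm : 0 ≤ m)
    (u : (Fin n → ℝ) → ℝ) (hu : IsMinimizer φ Ω m u) :
    ∃ j : ℕ, ∀ᵐ x ∂volume, u x ≤ (j : ℝ) := by
  by_contra hunb
  simp only [not_exists] at hunb
  obtain ⟨hadm, hmin⟩ := hu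
  obtain ⟨⟨hui, hTV⟩, hΩ, hN, -⟩ := id hadm
  have hn0 : n ≠ 0 := by omega
  have hu0 : 0 ≤ᵐ[volume] u := by
    filter_upwards [hN] with x ⟨k, hk⟩
    rw [hk]
    exact k.cast_nonneg
  obtain ⟨x, hx⟩ := hΩne
  obtain ⟨R, hR, hRsub⟩ := hφ.exists_wulffBall_subset hΩopen hx
  obtain ⟨j, hj⟩ := ((tendsto_integral_max_sub_natCast hui).eventually_lt_const
    (hφ.volume_real_wulffBall_pos x hR)).exists
  obtain ⟨hAfin, hAlt⟩ := volume_real_lt_integral_max_sub hΩfin hui hΩ hN j (hunb _)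
  set w : (Fin n → ℝ) → ℝ := fun y => max (u y - j) 0 with hw
  set s := volume.real {y | 0 < w y} with hs
  set δ := ∫ y, w y with hδ
  have hs0 : 0 ≤ s := measureReal_nonneg
  obtain ⟨r, hr, hrvol⟩ := hφ.exists_volume_real_wulffBall_eq hn0 x (a := δ) (by linarith)
  obtain ⟨ρ, hρ, hρvol⟩ :=
    hφ.exists_volume_real_wulffBall_eq hn0 0 (a := (s + δ) / 2) (by linarith)
  have hρr : ρ < r := hφ.lt_of_volume_real_wulffBall_lt hρ hr (by linarith)
  have hrR : r < R := hφ.lt_of_volume_real_wulffBall_lt hr hR (by linarith)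
  have hsplit := anisoTV_truncation_add_le hφ hui hu0 hTV j.cast_nonneg
  have hiso := mul_integral_le_anisoTV hφ (integrable_max_sub_const hui j.cast_nonneg)
    (Eventually.of_forall fun y => le_max_right _ _)
    (ne_top_of_le_ne_top hTV (le_add_self.trans hsplit)) hρ (by
      rw [← hφ.volume_wulffBall 0 hρ, ← ENNReal.toReal_lt_toReal hAfin
        (hφ.volume_wulffBall_lt_top 0 hρ).ne]
      change s < volume.real (wulffBall φ 0 ρ)
      linarith)
  have hTVmin : anisoTV φ (fun y => min (u y) j) ≠ ∞ :=
    ne_top_of_le_ne_top hTV (le_self_add.trans hsplit)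
  have hlt : anisoTV φ (fun y => min (u y) j + (wulffBall φ x r).indicator 1 y) <
      anisoTV φ u := by
    have hWm : MeasurableSet (wulffBall φ x r) := (hφ.isOpen_wulffBall x r).measurableSet
    calc _ ≤ anisoTV φ (fun y => min (u y) j) + anisoPerimeter φ (wulffBall φ x r) :=
          anisoTV_add_le (integrable_min_const hui j.cast_nonneg)
            ((integrable_indicator_iff hWm).2
              (integrableOn_const (hφ.volume_wulffBall_lt_top x hr).ne))
      _ ≤ anisoTV φ (fun y => min (u y) j) + ENNReal.ofReal (n / r * δ) := by
          gcongr
          exact hrvol ▸ anisoPerimeter_wulffBall_le hφ x hr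
      _ < anisoTV φ (fun y => min (u y) j) + ENNReal.ofReal (n / ρ * δ) := by
          have hδ0 : 0 < δ := by linarith
          have hnpos : (0 : ℝ) < n := by exact_mod_cast hn
          refine ENNReal.add_lt_add_left hTVmin ?_
          rw [ENNReal.ofReal_lt_ofReal_iff (by positivity)]
          gcongr
      _ ≤ anisoTV φ (fun y => min (u y) j) + anisoTV φ w := by
          gcongr
          exact ENNReal.ofReal_le_of_le_toReal hiso
      _ ≤ anisoTV φ u := hsplit
  exact (hmin _ (hadm.truncation_add_wulffBall hφ j hr
    (fun y hy => hRsub (lt_trans hy hrR)) hrvol hlt.ne_top)).not_gt hlt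

end
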